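/- arXiv:2507.03244 — 2 statements merged into one kernel-verified Lean document; each statement's English description precedes it below -/
import Mathlib

section
/- Let G be a graph and let Z ⊆ V(G) with |Z| = 4 be such that (G,Z) is internally 4-connected. If G has no Z-rooted K*_{4,2}-model then |E(G)| ≤ 4|V(G)| − 10. -/
open SimpleGraph

/-- `K7vee` is the graph obtained from `K 7` by deleting two edges with a common end. -/
def K7vee : SimpleGraph (Fin 7) :=
  (completeGraph (Fin 7)).deleteEdges {s(0, 1), s(0, 2)}

/-- `K6vee` is the graph obtained from `K 6` by deleting two edges with a common end. -/
def K6vee : SimpleGraph (Fin 6) :=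
  (completeGraph (Fin 6)).deleteEdges {s(0, 1), s(0, 2)}

/-- The complete multipartite graph with four parts of size two. -/
def K2222 : SimpleGraph (Fin 4 × Fin 2) :=
  SimpleGraph.comap Prod.fst (completeGraph (Fin 4))

/-- `H` is a minor of `G`: there is a model of `H` in `G`, i.e. a family of pairwise disjoint
nonempty connected branch sets, one for each vertex of `H`, with edges of `G` between branch
sets corresponding to adjacent vertices of `H`. -/
def IsMinor {W V : Type} (H : SimpleGraph W) (G : SimpleGraph V) : Prop :=
  ∃ bag : W → Set V,
    (∀ w, (G.induce (bag w)).Connected) ∧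
    (∀ w w', w ≠ w' → Disjoint (bag w) (bag w')) ∧
    (∀ w w', H.Adj w w' → ∃ u ∈ bag w, ∃ v ∈ bag w', G.Adj u v)

/-- A graph is `k`-connected if it has more than `k` vertices and stays connected after
removing any set of fewer than `k` vertices. -/
def IsKConnected {V : Type} [Fintype V] (k : ℕ) (G : SimpleGraph V) : Prop :=
  k < Fintype.card V ∧ ∀ S : Set V, S.ncard < k → (G.induce (Sᶜ : Set V)).Connected

/-- A separation of `G`: `A ∪ B = V(G)` and no edge joins `A - B` to `B - A`. -/
def IsSeparation {V : Type} (G : SimpleGraph V) (A B : Set V) : Prop :=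
  A ∪ B = Set.univ ∧ ∀ ⦃u v : V⦄, G.Adj u v → ¬(u ∈ A \ B ∧ v ∈ B \ A)

/-- `(G, Z)` is internally `k`-connected: every separation `(A,B)` of `G` with `Z ⊆ A`
and `B - A ≠ ∅` has order at least `k`. -/
def InternallyConnected {V : Type} (G : SimpleGraph V) (Z : Set V) (k : ℕ) : Prop :=
  ∀ A B : Set V, IsSeparation G A B → Z ⊆ A → (B \ A).Nonempty →
    k ≤ (A ∩ B).ncard

/-- A `Z`-rooted `K₄`-model in `G`. -/
def HasRootedK4Model {V : Type} (G : SimpleGraph V) (Z : Set V) : Prop :=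
  ∃ B : Fin 4 → Set V,
    (∀ i, (G.induce (B i)).Connected) ∧
    (∀ i j, i ≠ j → Disjoint (B i) (B j)) ∧
    (∀ i, ∃! z : V, z ∈ Z ∧ z ∈ B i) ∧
    (∀ z ∈ Z, ∃ i, z ∈ B i) ∧
    (∀ i j, i ≠ j → ∃ u ∈ B i, ∃ v ∈ B j, G.Adj u v)

/-- A `Z`-rooted `K*₄,₂`-model in `G`. -/
def HasRootedK42starModel {V : Type} (G : SimpleGraph V) (Z : Set V) : Prop :=
  ∃ (B : Fin 4 → Set V) (C : Fin 2 → Set V),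
    (∀ i, (G.induce (B i)).Connected) ∧
    (∀ j, (G.induce (C j)).Connected) ∧
    (∀ i j, i ≠ j → Disjoint (B i) (B j)) ∧
    (∀ i j, i ≠ j → Disjoint (C i) (C j)) ∧
    (∀ i j, Disjoint (B i) (C j)) ∧
    (∀ i, ∃! z : V, z ∈ Z ∧ z ∈ B i) ∧
    (∀ z ∈ Z, ∃ i, z ∈ B i) ∧
    (∀ i j, ∃ u ∈ B i, ∃ v ∈ C j, G.Adj u v) ∧
    (∃ u ∈ C 0, ∃ v ∈ C 1, G.Adj u v)

/-- An enemy: a `4`-connected graph with `|E(G)| ≥ 4|V(G)| - 8`, with no `K7vee`-minor,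
not isomorphic to `K_{2,2,2,2}`. -/
def Enemy {V : Type} [Fintype V] (G : SimpleGraph V) : Prop :=
  IsKConnected 4 G ∧
    4 * (Fintype.card V : ℤ) - 8 ≤ (G.edgeSet.ncard : ℤ) ∧
    ¬ IsMinor K7vee G ∧
    IsEmpty (G ≃g K2222)

/-- A minor-minimal enemy: an enemy, no minor of which, other than itself, is an enemy. -/
def MinorMinimalEnemy {V : Type} [Fintype V] (G : SimpleGraph V) : Prop :=
  Enemy G ∧ ∀ (W : Type) [Fintype W] (H : SimpleGraph W),
    IsMinor H G → Enemy H → Nonempty (H ≃g G)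

/-- The simple graph obtained from `G` by contracting the edge `uv`
(`v` is merged into `u`). -/
def contractEdge {V : Type} (G : SimpleGraph V) (u v : V) :
    SimpleGraph {x : V // x ≠ v} :=
  SimpleGraph.fromRel (fun x y => G.Adj ↑x ↑y ∨ ((x : V) = u ∧ G.Adj v ↑y))

/-- A graph is `7`-contraction-critical if its chromatic number is `7` and
every minor of it, other than itself, has chromatic number less than `7`. -/
def ContractionCritical7 {V : Type} [Fintype V] (G : SimpleGraph V) : Prop :=
  G.chromaticNumber = 7 ∧
    ∀ (W : Type) [Fintype W] (H : SimpleGraph W),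
      IsMinor H G → IsEmpty (H ≃g G) → H.chromaticNumber < 7

namespace RootedModel

open scoped Classical in
/-- The vertices outside `Y` with a neighbour in `Y`. -/
noncomputable def boundary {V : Type*} [Fintype V] (G : SimpleGraph V) (Y : Finset V) : Finset V :=
  Finset.univ.filter fun x => x ∉ Y ∧ ∃ y ∈ Y, G.Adj y x

open scoped Classical in
/-- The darts of `G` with an end in `Y`: every edge meeting `Y` is counted twice. -/
noncomputable def darts {V : Type*} [Fintype V] (G : SimpleGraph V) (Y : Finset V) :
    Finset (V × V) :=
  Finset.univ.filter fun p => G.Adj p.1 p.2 ∧ (p.1 ∈ Y ∨ p.2 ∈ Y)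

/-- `P` is nonempty and induces a connected subgraph, expressed through cuts. -/
def Conn {V : Type*} (G : SimpleGraph V) (P : Finset V) : Prop :=
  P.Nonempty ∧ ∀ Q ⊆ P, Q.Nonempty → Q ≠ P → ∃ a ∈ Q, ∃ b ∈ P, b ∉ Q ∧ G.Adj a b

/-- Some edge of `G` joins `P` to `Q`. -/
def Touch {V : Type*} (G : SimpleGraph V) (P Q : Finset V) : Prop :=
  ∃ a ∈ P, ∃ b ∈ Q, G.Adj a b

/-- The sets `B z`, for `z ∈ Z`, are disjoint, connected, and `B z` consists of `z` and
vertices of `X`. -/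
structure Rooted {V : Type*} (G : SimpleGraph V) (X Z : Finset V) (B : V → Finset V) : Prop where
  conn : ∀ z ∈ Z, Conn G (B z)
  root : ∀ z ∈ Z, z ∈ B z
  sub : ∀ z ∈ Z, ∀ x ∈ B z, x = z ∨ x ∈ X
  disj : ∀ z ∈ Z, ∀ w ∈ Z, z ≠ w → Disjoint (B z) (B w)

/-- A complete-graph model rooted at `Z` in `X ∪ Z`. -/
def HasClique {V : Type*} (G : SimpleGraph V) (X Z : Finset V) : Prop :=
  ∃ B, Rooted G X Z B ∧ ∀ z ∈ Z, ∀ w ∈ Z, z ≠ w → Touch G (B z) (B w)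

/-- A `Z`-rooted model in `X ∪ Z` of the graph obtained from an edge by adding `|Z|` vertices
adjacent to both of its ends. -/
def HasModel {V : Type*} (G : SimpleGraph V) (X Z : Finset V) : Prop :=
  ∃ B C D, Rooted G X Z B ∧ Conn G C ∧ Conn G D ∧ C ⊆ X ∧ D ⊆ X ∧ Disjoint C D ∧ Touch G C D ∧
    ∀ z ∈ Z, Disjoint (B z) C ∧ Disjoint (B z) D ∧ Touch G (B z) C ∧ Touch G (B z) D

/-- Many edges meet `X`, the only vertices attaching to `X` lie in `Z`, and few edges meet any
part of `X` that can be separated from `Z` by fewer than `|Z|` vertices. -/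
structure Massed {V : Type*} [Fintype V] (G : SimpleGraph V) (X Z : Finset V) : Prop where
  disj : Disjoint X Z
  bdry : boundary G X ⊆ Z
  card_le : Z.card ≤ 4
  dense : 8 * X.card < (darts G X).card
  sparse : ∀ Y ⊆ X, (boundary G Y).card < Z.card → (darts G Y).card ≤ 8 * Y.card

/-- `φ` and `r` exhibit `(G', X', Z')` as a rooted minor of `(G, X, Z)`. -/
structure Embedding {V : Type*} (G' : SimpleGraph V) (X' Z' : Finset V) (G : SimpleGraph V)
    (X Z : Finset V) (φ : V → Finset V) (r : V → V) : Prop where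
  conn : ∀ x, x ∈ X' ∨ x ∈ Z' → Conn G (φ x)
  disj : ∀ x y, x ∈ X' ∨ x ∈ Z' → y ∈ X' ∨ y ∈ Z' → x ≠ y → Disjoint (φ x) (φ y)
  adj : ∀ x y, x ∈ X' → y ∈ X' ∨ y ∈ Z' → G'.Adj x y → Touch G (φ x) (φ y)
  sub : ∀ x ∈ X', φ x ⊆ X
  root_mem : ∀ z ∈ Z, r z ∈ Z'
  root_inj : ∀ z ∈ Z, ∀ w ∈ Z, r z = r w → z = w
  root : ∀ z ∈ Z, z ∈ φ (r z)
  root_sub : ∀ z ∈ Z, ∀ x ∈ φ (r z), x = z ∨ x ∈ X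

section

open scoped Classical

variable {V : Type*} {G G' : SimpleGraph V} {P Q X Y Z : Finset V}

theorem Touch.symm (h : Touch G P Q) : Touch G Q P := by
  obtain ⟨a, ha, b, hb, h⟩ := h
  exact ⟨b, hb, a, ha, h.symm⟩

theorem Touch.mono {P' Q' : Finset V} (h : Touch G P Q) (hP : P ⊆ P') (hQ : Q ⊆ Q') :
    Touch G P' Q' := by
  obtain ⟨a, ha, b, hb, h⟩ := h
  exact ⟨a, hP ha, b, hQ hb, h⟩

theorem Conn.singleton (G : SimpleGraph V) (x : V) : Conn G {x} :=
  ⟨Finset.singleton_nonempty x, fun _ hQ hne hQ' =>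
    absurd ((Finset.subset_singleton_iff.1 hQ).resolve_left hne.ne_empty) hQ'⟩

theorem Conn.biUnion {φ : V → Finset V} (hP : Conn G' P) (hφ : ∀ x ∈ P, Conn G (φ x))
    (h : ∀ x ∈ P, ∀ y ∈ P, G'.Adj x y → Touch G (φ x) (φ y)) : Conn G (P.biUnion φ) := by
  obtain ⟨⟨p, hp⟩, hcut⟩ := hP
  refine ⟨?_, fun Q hQ hne hneq => ?_⟩
  · obtain ⟨q, hq⟩ := (hφ p hp).1
    exact ⟨q, Finset.mem_biUnion.2 ⟨p, hp, hq⟩⟩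
  by_cases hsplit : ∃ x ∈ P, (φ x ∩ Q).Nonempty ∧ φ x ∩ Q ≠ φ x
  · obtain ⟨x, hx, h1, h2⟩ := hsplit
    obtain ⟨a, ha, b, hb, hbQ, hab⟩ := (hφ x hx).2 _ Finset.inter_subset_left h1 h2
    exact ⟨a, (Finset.mem_inter.1 ha).2, b, Finset.mem_biUnion.2 ⟨x, hx, hb⟩,
      fun hb' => hbQ (Finset.mem_inter.2 ⟨hb, hb'⟩), hab⟩
  push Not at hsplit
  have hall : ∀ x ∈ P, ∀ q ∈ φ x, q ∈ Q → φ x ⊆ Q := fun x hx q hq hqQ =>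
    Finset.inter_eq_left.1 (hsplit x hx ⟨q, Finset.mem_inter.2 ⟨hq, hqQ⟩⟩)
  obtain ⟨a, ha, b, hb, hb', hab⟩ := hcut (P.filter fun x => φ x ⊆ Q) (Finset.filter_subset _ _)
    (by
      obtain ⟨q, hq⟩ := hne
      obtain ⟨x, hx, hqx⟩ := Finset.mem_biUnion.1 (hQ hq)
      exact ⟨x, Finset.mem_filter.2 ⟨hx, hall x hx q hqx hq⟩⟩)
    (fun heq => hneq (Finset.Subset.antisymm hQ (Finset.biUnion_subset.2 fun x hx => by
      rw [← heq] at hx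
      exact (Finset.mem_filter.1 hx).2)))
  obtain ⟨haP, haQ⟩ := Finset.mem_filter.1 ha
  obtain ⟨c, hc, d, hd, hcd⟩ := h a haP b hb hab
  refine ⟨c, haQ hc, d, Finset.mem_biUnion.2 ⟨b, hb, hd⟩, fun hdQ => hb' ?_, hcd⟩
  exact Finset.mem_filter.2 ⟨hb, hall b hb d hd hdQ⟩

theorem Conn.mono (hP : Conn G' P) (h : ∀ x y, G'.Adj x y → G.Adj x y) : Conn G P :=
  ⟨hP.1, fun Q hQ hne hneq => by
    obtain ⟨a, ha, b, hb, hbQ, hab⟩ := hP.2 Q hQ hne hneq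
    exact ⟨a, ha, b, hb, hbQ, h _ _ hab⟩⟩

theorem Conn.union (hP : Conn G P) (hQ : Conn G Q) (h : Touch G P Q) : Conn G (P ∪ Q) := by
  refine ⟨hP.1.mono Finset.subset_union_left, fun R hR hne hneq => ?_⟩
  by_cases h1 : (P ∩ R).Nonempty ∧ P ∩ R ≠ P
  · obtain ⟨a, ha, b, hb, hbQ, hab⟩ := hP.2 _ Finset.inter_subset_left h1.1 h1.2
    exact ⟨a, by grind, b, by grind, by grind, hab⟩
  by_cases h2 : (Q ∩ R).Nonempty ∧ Q ∩ R ≠ Q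
  · obtain ⟨a, ha, b, hb, hbQ, hab⟩ := hQ.2 _ Finset.inter_subset_left h2.1 h2.2
    exact ⟨a, by grind, b, by grind, by grind, hab⟩
  obtain ⟨a, ha, b, hb, hab⟩ := h
  have hP' : P ⊆ R ∨ Disjoint P R := by
    by_cases h : (P ∩ R).Nonempty
    · exact .inl (Finset.inter_eq_left.1 (by tauto))
    · exact .inr (Finset.disjoint_iff_inter_eq_empty.2 (Finset.not_nonempty_iff_eq_empty.1 h))
  have hQ' : Q ⊆ R ∨ Disjoint Q R := by
    by_cases h : (Q ∩ R).Nonempty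
    · exact .inl (Finset.inter_eq_left.1 (by tauto))
    · exact .inr (Finset.disjoint_iff_inter_eq_empty.2 (Finset.not_nonempty_iff_eq_empty.1 h))
  rcases hP' with hP' | hP' <;> rcases hQ' with hQ' | hQ'
  · exact absurd (Finset.Subset.antisymm hR (Finset.union_subset hP' hQ')) hneq
  · exact ⟨a, hP' ha, b, Finset.mem_union_right _ hb, Finset.disjoint_left.1 hQ' hb, hab⟩
  · exact ⟨b, hQ' hb, a, Finset.mem_union_left _ ha, Finset.disjoint_left.1 hP' ha, hab.symm⟩
  · obtain ⟨x, hx⟩ := hne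
    rcases Finset.mem_union.1 (hR hx) with hx' | hx'
    · exact absurd hx (Finset.disjoint_left.1 hP' hx')
    · exact absurd hx (Finset.disjoint_left.1 hQ' hx')

theorem Conn.insert {a b : V} (hP : Conn G P) (hb : b ∈ P) (hab : G.Adj a b) :
    Conn G (insert a P) :=
  (Conn.singleton G a).union hP ⟨a, Finset.mem_singleton_self a, b, hb, hab⟩

theorem HasModel.lift {X' Z' : Finset V} {φ : V → Finset V} {r : V → V}
    (h : HasModel G' X' Z') (e : Embedding G' X' Z' G X Z φ r) : HasModel G X Z := by
  obtain ⟨B, C, D, hB, hC, hD, hCX, hDX, hCD, htCD, hroot⟩ := h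
  have hBmem : ∀ z ∈ Z', ∀ x ∈ B z, x ∈ X' ∨ x ∈ Z' := fun z hz x hx => by
    rcases hB.sub z hz x hx with rfl | h
    · exact .inr hz
    · exact .inl h
  have hdisj : ∀ {S T : Finset V}, (∀ x ∈ S, x ∈ X' ∨ x ∈ Z') → (∀ x ∈ T, x ∈ X' ∨ x ∈ Z') →
      Disjoint S T → Disjoint (S.biUnion φ) (T.biUnion φ) := by
    intro S T hS hT hST
    rw [Finset.disjoint_biUnion_left]
    intro x hx
    rw [Finset.disjoint_biUnion_right]
    intro y hy
    exact e.disj x y (hS x hx) (hT y hy) fun hxy => Finset.disjoint_left.1 hST hx (hxy ▸ hy)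
  have htouch : ∀ {S T : Finset V}, (∀ x ∈ S, x ∈ X' ∨ x ∈ Z') → T ⊆ X' →
      Touch G' S T → Touch G (S.biUnion φ) (T.biUnion φ) := by
    rintro S T hS hT ⟨a, ha, b, hb, hab⟩
    exact (e.adj b a (hT hb) (hS a ha) hab.symm).symm.mono
      (Finset.subset_biUnion_of_mem φ ha) (Finset.subset_biUnion_of_mem φ hb)
  have hconn : ∀ {S : Finset V}, S ⊆ X' → Conn G' S → Conn G (S.biUnion φ) := fun hS hS' =>
    hS'.biUnion (fun x hx => e.conn x (.inl (hS hx)))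
      fun x hx y hy hxy => e.adj x y (hS hx) (.inl (hS hy)) hxy
  have hsub : ∀ {S : Finset V}, S ⊆ X' → S.biUnion φ ⊆ X := fun hS =>
    Finset.biUnion_subset.2 fun x hx => e.sub x (hS hx)
  refine ⟨fun z => (B (r z)).biUnion φ, C.biUnion φ, D.biUnion φ, ⟨?_, ?_, ?_, ?_⟩, hconn hCX hC,
    hconn hDX hD, hsub hCX, hsub hDX, hdisj (fun x hx => .inl (hCX hx))
      (fun x hx => .inl (hDX hx)) hCD, htouch (fun x hx => .inl (hCX hx)) hDX htCD, ?_⟩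
  · intro z hz
    have hz' := e.root_mem z hz
    refine (hB.conn _ hz').biUnion (fun x hx => e.conn x (hBmem _ hz' x hx))
      fun x hx y hy hxy => ?_
    rcases hB.sub _ hz' x hx with rfl | hx'
    · rcases hB.sub _ hz' y hy with rfl | hy'
      · exact absurd hxy (G'.loopless.irrefl _)
      · exact (e.adj y _ hy' (.inr hz') hxy.symm).symm
    · exact e.adj x y hx' (hBmem _ hz' y hy) hxy
  · intro z hz
    exact Finset.mem_biUnion.2 ⟨r z, hB.root _ (e.root_mem z hz), e.root z hz⟩
  · intro z hz x hx
    obtain ⟨y, hy, hxy⟩ := Finset.mem_biUnion.1 hx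
    rcases hB.sub _ (e.root_mem z hz) y hy with rfl | hy'
    · exact e.root_sub z hz x hxy
    · exact .inr (e.sub y hy' hxy)
  · intro z hz w hw hzw
    exact hdisj (hBmem _ (e.root_mem z hz)) (hBmem _ (e.root_mem w hw))
      (hB.disj _ (e.root_mem z hz) _ (e.root_mem w hw) fun h => hzw (e.root_inj z hz w hw h))
  · intro z hz
    have hz' := e.root_mem z hz
    obtain ⟨h1, h2, h3, h4⟩ := hroot _ hz'
    exact ⟨hdisj (hBmem _ hz') (fun x hx => .inl (hCX hx)) h1,
      hdisj (hBmem _ hz') (fun x hx => .inl (hDX hx)) h2,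
      htouch (hBmem _ hz') hCX h3, htouch (hBmem _ hz') hDX h4⟩

theorem HasModel.mono_of_adj (h : HasModel G' X Z)
    (hadj : ∀ x y, G'.Adj x y → G.Adj x y) : HasModel G X Z := by
  refine h.lift (φ := fun x => {x}) (r := id) ⟨fun x _ => Conn.singleton G x, ?_, ?_, ?_, ?_, ?_,
    ?_, ?_⟩
  · intro x y _ _ hxy
    simpa using hxy
  · intro x y _ _ hxy
    exact ⟨x, by simp, y, by simp, hadj _ _ hxy⟩
  all_goals simp

theorem HasModel.hasClique (h : HasModel G X Z) (hZ : Z.card ≤ 3) : HasClique G X Z := by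
  obtain ⟨B, C, D, hB, hC, hD, hCX, hDX, hCD, -, hroot⟩ := h
  by_cases hone : Z.card ≤ 1
  · exact ⟨B, hB, fun z hz w hw hzw => absurd (Finset.card_le_one.1 hone z hz w hw) hzw⟩
  obtain ⟨p, hp, q, hq, hpq⟩ := Finset.one_lt_card.1 (not_le.1 hone)
  have hrest : ∀ z ∈ Z, ∀ w ∈ Z, z ≠ p → z ≠ q → w ≠ p → w ≠ q → z = w := by
    intro z hz w hw h1 h2 h3 h4
    by_contra hzw
    have : ({p, q, z, w} : Finset V).card ≤ Z.card := Finset.card_le_card (by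
      simp only [Finset.insert_subset_iff, Finset.singleton_subset_iff]
      exact ⟨hp, hq, hz, hw⟩)
    have : ({p, q, z, w} : Finset V).card = 4 := by
      rw [Finset.card_insert_of_notMem (by grind), Finset.card_insert_of_notMem (by grind),
        Finset.card_pair hzw]
    omega
  refine ⟨fun z => if z = p then B z ∪ C else if z = q then B z ∪ D else B z,
    ⟨?_, ?_, ?_, ?_⟩, ?_⟩
  · intro z hz
    have := hroot z hz
    split_ifs
    · exact (hB.conn z hz).union hC this.2.2.1
    · exact (hB.conn z hz).union hD this.2.2.2
    · exact hB.conn z hz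
  · intro z hz
    have := hB.root z hz
    grind
  · intro z hz x hx
    have := hB.sub z hz x
    grind
  · intro z hz w hw hzw
    have h1 := hB.disj z hz w hw hzw
    have h2 := hroot z hz
    have h3 := hroot w hw
    have h4 := h2.1
    have h5 := h2.2.1
    have h6 := h3.1
    have h7 := h3.2.1
    have h8 := hCD.symm
    have h9 := h4.symm
    have h10 := h5.symm
    split_ifs <;> first
      | exact absurd (‹z = p›.trans ‹w = p›.symm) hzw
      | exact absurd (‹z = q›.trans ‹w = q›.symm) hzw
      | simp [Finset.disjoint_union_left, Finset.disjoint_union_right, h1, h4, h5, hCD,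
          h8, h6.symm, h7.symm]
  · have hle : ∀ z, B z ⊆ if z = p then B z ∪ C else if z = q then B z ∪ D else B z := by
      intro z
      split_ifs <;> simp
    have hC' : ∀ w ∈ Z, Touch G (B w) C := fun w hw => (hroot w hw).2.2.1
    have hD' : ∀ w ∈ Z, Touch G (B w) D := fun w hw => (hroot w hw).2.2.2
    intro z hz w hw hzw
    by_cases hzp : z = p
    · exact (hC' w hw).symm.mono (by simp [hzp]) (hle w)
    by_cases hwp : w = p
    · exact (hC' z hz).mono (hle z) (by simp [hwp])
    by_cases hzq : z = q
    · exact (hD' w hw).symm.mono (by simp [hzq, hpq.symm]) (hle w)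
    by_cases hwq : w = q
    · exact (hD' z hz).mono (hle z) (by simp [hwq, hpq.symm])
    exact absurd (hrest z hz w hw hzp hzq hwp hwq) hzw

theorem HasModel.of_clique {N X' Z' : Finset V} (hY : HasClique G Y N)
    (hadj : ∀ x y, G'.Adj x y → G.Adj x y ∨ x ∈ N ∧ y ∈ N) (h1 : Disjoint Y X')
    (h2 : Disjoint Y Z') (h3 : Y ⊆ X) (h4 : X' ⊆ X) (h5 : Z ⊆ Z')
    (h : HasModel G' X' Z') : HasModel G X Z := by
  obtain ⟨B, hB, hBB⟩ := hY
  have hnot : ∀ x, x ∈ X' ∨ x ∈ Z' → x ∉ Y := by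
    rintro x (hx | hx)
    · exact Finset.disjoint_right.1 h1 hx
    · exact Finset.disjoint_right.1 h2 hx
  have hroot : ∀ x, x ∈ if x ∈ N then B x else {x} := by
    intro x
    split_ifs with hx
    · exact hB.root x hx
    · exact Finset.mem_singleton_self x
  have hmem : ∀ x y, (y ∈ if x ∈ N then B x else {x}) → y = x ∨ y ∈ Y := by
    intro x y hy
    split_ifs at hy with hx
    · exact hB.sub x hx y hy
    · exact .inl (Finset.mem_singleton.1 hy)
  refine h.lift (φ := fun x => if x ∈ N then B x else {x}) (r := id) ⟨?_, ?_, ?_, ?_, fun z hz => h5 hz,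
    fun _ _ _ _ h => h, fun z _ => hroot z, ?_⟩
  · intro x _
    split_ifs with hx
    · exact hB.conn x hx
    · exact Conn.singleton G x
  · intro x y hx hy hxy
    by_cases hxy' : x ∈ N ∧ y ∈ N
    · simpa only [hxy'.1, hxy'.2, if_true] using hB.disj x hxy'.1 y hxy'.2 hxy
    rw [Finset.disjoint_left]
    intro w hwx hwy
    have := hmem x w hwx
    have := hmem y w hwy
    have := hnot x hx
    have := hnot y hy
    grind
  · intro x y hx hy hxy
    rcases hadj x y hxy with h | h
    · exact ⟨x, hroot x, y, hroot y, h⟩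
    · simpa only [h.1, h.2, if_true] using hBB x h.1 y h.2 hxy.ne
  · intro x hx y hy
    rcases hmem x y hy with rfl | h
    · exact h4 hx
    · exact h3 h
  · intro z hz x hx
    exact (hmem z x hx).imp_right fun h => h3 h

theorem HasModel.mono_left {X' : Finset V} (h : HasModel G X' Z) (hX : X' ⊆ X) :
    HasModel G X Z := by
  obtain ⟨B, C, D, hB, hC, hD, hCX, hDX, h⟩ := h
  exact ⟨B, C, D, ⟨hB.conn, hB.root, fun z hz x hx => (hB.sub z hz x hx).imp_right fun h => hX h,
    hB.disj⟩, hC, hD, hCX.trans hX, hDX.trans hX, h⟩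

theorem Conn.pair {a b : V} (h : G.Adj a b) : Conn G {a, b} :=
  (Conn.singleton G b).insert (Finset.mem_singleton_self b) h

/-- A dominating connected set or a nearly dominating edge in a small graph of large minimum
degree. -/
theorem exists_dominating {T R : Finset V} (hT : T.card = 4)
    (hR : R.card ≤ 4) (hdeg : ∀ r ∈ R, 4 ≤ ((T ∪ R).filter fun x => G.Adj r x).card)
    (hadj : ∀ t ∈ T, ∃ r ∈ R, G.Adj t r) :
    (∃ D ⊆ R, Conn G D ∧ ∀ t ∈ T, ∃ d ∈ D, G.Adj t d) ∨
      ∃ r₁ ∈ R, ∃ r₂ ∈ R, G.Adj r₁ r₂ ∧ ∃ t₀ ∈ T, ∀ t ∈ T, t ≠ t₀ → G.Adj t r₁ ∧ G.Adj t r₂ := by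
  by_cases hconn : Conn G R
  · exact .inl ⟨R, le_rfl, hconn, hadj⟩
  obtain ⟨t, ht⟩ : T.Nonempty := Finset.card_pos.1 (by omega)
  obtain ⟨r, hr, -⟩ := hadj t ht
  obtain ⟨Q, hQR, hQne, hQ2, hQ⟩ : ∃ Q ⊆ R, Q.Nonempty ∧ Q.card ≤ 2 ∧
      ∀ a ∈ Q, ∀ b ∈ R, b ∉ Q → ¬ G.Adj a b := by
    have : ∃ Q ⊆ R, Q.Nonempty ∧ Q ≠ R ∧ ∀ a ∈ Q, ∀ b ∈ R, b ∉ Q → ¬ G.Adj a b := by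
      by_contra! h
      exact hconn ⟨⟨r, hr⟩, h⟩
    obtain ⟨Q, hQR, hQne, hQR', hQ⟩ := this
    by_cases hQ2 : Q.card ≤ 2
    · exact ⟨Q, hQR, hQne, hQ2, hQ⟩
    · have := Finset.card_sdiff_add_card_eq_card hQR
      refine ⟨R \ Q, Finset.sdiff_subset, ?_, by omega, ?_⟩
      · exact Finset.sdiff_nonempty.2 fun h => hQR' (Finset.Subset.antisymm hQR h)
      · intro a ha b hb hbQ hab
        simp only [Finset.mem_sdiff, not_and, not_not] at ha hbQ
        exact hQ b (hbQ hb) a ha.1 ha.2 hab.symm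
  have hall : ∀ r ∈ Q, (∀ x ∈ Q, ¬ G.Adj r x) → ∀ t ∈ T, ∃ d ∈ ({r} : Finset V), G.Adj t d := by
    intro r hr hrQ t ht
    have h1 : ((T ∪ R).filter fun x => G.Adj r x) ⊆ T := by
      intro x hx
      simp only [Finset.mem_filter, Finset.mem_union] at hx
      refine hx.1.resolve_right fun hxR => ?_
      by_cases hxQ : x ∈ Q
      · exact hrQ x hxQ hx.2
      · exact hQ r hr x hxR hxQ hx.2
    have h2 := Finset.eq_of_subset_of_card_le h1 (by rw [hT]; exact hdeg r (hQR hr))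
    rw [← h2] at ht
    exact ⟨r, Finset.mem_singleton_self r, (Finset.mem_filter.1 ht).2.symm⟩
  by_cases hedge : ∃ a ∈ Q, ∃ b ∈ Q, G.Adj a b
  · obtain ⟨a, ha, b, hb, hab⟩ := hedge
    have hQab : Q = {a, b} := (Finset.eq_of_subset_of_card_le
      (Finset.insert_subset ha (Finset.singleton_subset_iff.2 hb))
      (by rw [Finset.card_pair hab.ne]; exact hQ2)).symm
    by_cases hdom : ∀ t ∈ T, ∃ d ∈ ({a, b} : Finset V), G.Adj t d
    · exact .inl ⟨{a, b}, hQab ▸ hQR, Conn.pair hab, hdom⟩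
    right
    push Not at hdom
    obtain ⟨t₀, ht₀, hno⟩ := hdom
    have hkey : ∀ r ∈ Q, ∀ s ∈ Q, r ≠ s → ∀ t ∈ T, t ≠ t₀ → G.Adj t r := by
      intro r hr s hs hrs t ht htt
      have h1 : ((T ∪ R).filter fun x => G.Adj r x) ⊆ insert s (T.erase t₀) := by
        intro x hx
        simp only [Finset.mem_filter, Finset.mem_union, Finset.mem_insert,
          Finset.mem_erase] at hx ⊢
        rcases hx.1 with h | h
        · refine .inr ⟨?_, h⟩
          rintro rfl
          exact hno r (hQab ▸ hr) hx.2.symm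
        · by_cases hxQ : x ∈ Q
          · rw [hQab] at hr hs hxQ
            have := hx.2.ne
            simp only [Finset.mem_insert, Finset.mem_singleton] at hr hs hxQ
            grind
          · exact absurd hx.2 (hQ r hr x h hxQ)
      have h2 := Finset.eq_of_subset_of_card_le h1 (by
        have := Finset.card_insert_le s (T.erase t₀)
        have := hdeg r (hQR hr)
        rw [Finset.card_erase_of_mem ht₀] at *
        omega)
      have ht' : t ∈ insert s (T.erase t₀) :=
        Finset.mem_insert_of_mem (Finset.mem_erase.2 ⟨htt, ht⟩)
      rw [← h2] at ht'
      exact (Finset.mem_filter.1 ht').2.symm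
    exact ⟨a, hQR ha, b, hQR hb, hab, t₀, ht₀, fun t ht htt =>
      ⟨hkey a ha b hb hab.ne t ht htt, hkey b hb a ha hab.ne' t ht htt⟩⟩
  · push Not at hedge
    obtain ⟨r, hr⟩ := hQne
    exact .inl ⟨{r}, Finset.singleton_subset_iff.2 (hQR hr), Conn.singleton G r,
      hall r hr (hedge r hr)⟩

theorem Conn.connected_induce (hP : Conn G P) : (G.induce (P : Set V)).Connected := by
  have hne : Nonempty (P : Set V) := hP.1.to_subtype
  refine ⟨fun a b => ?_⟩
  by_contra hab
  obtain ⟨Q, hQ⟩ : ∃ Q : Finset V, ∀ x, x ∈ Q ↔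
      ∃ h : x ∈ P, (G.induce (P : Set V)).Reachable a ⟨x, h⟩ :=
    ⟨P.filter fun x => ∃ h : x ∈ P, (G.induce (P : Set V)).Reachable a ⟨x, h⟩,
      fun x => by
        rw [Finset.mem_filter, and_iff_right_iff_imp]
        exact fun h => h.1⟩
  obtain ⟨x, hx, y, hy, hyQ, hxy⟩ := hP.2 Q (fun x hx => ((hQ x).1 hx).1)
    ⟨a, (hQ a).2 ⟨a.2, Reachable.refl a⟩⟩ (fun h => by
      have hb : (b : V) ∈ Q := h ▸ b.2
      exact hab ((hQ b).1 hb).2)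
  obtain ⟨hxP, hax⟩ := (hQ x).1 hx
  have hxy' : (G.induce (P : Set V)).Adj ⟨x, hxP⟩ ⟨y, hy⟩ := hxy
  exact hyQ ((hQ y).2 ⟨hy, hax.trans hxy'.reachable⟩)

variable [Fintype V]

theorem mem_boundary {x : V} : x ∈ boundary G Y ↔ x ∉ Y ∧ ∃ y ∈ Y, G.Adj y x := by
  simp [boundary]

theorem mem_darts {p : V × V} : p ∈ darts G Y ↔ G.Adj p.1 p.2 ∧ (p.1 ∈ Y ∨ p.2 ∈ Y) := by
  simp [darts]

/-- A form of Menger's theorem: if no set between `Y` and `Y₀` has a smaller boundary than `Y₀`,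
then disjoint connected sets link the boundary of `Y₀` to the boundary of `Y`. -/
theorem exists_linkage (n : ℕ) : ∀ (G : SimpleGraph V) (Y Y₀ : Finset V), Y ⊆ Y₀ →
    (Y₀ \ Y).card ≤ n →
    (∀ Y₁, Y ⊆ Y₁ → Y₁ ⊆ Y₀ → (boundary G Y₀).card ≤ (boundary G Y₁).card) →
    ∃ (P : V → Finset V) (t : V → V),
      (∀ a ∈ boundary G Y₀, Conn G (P a) ∧ a ∈ P a ∧ (∀ x ∈ P a, x = a ∨ x ∈ Y₀ ∧ x ∉ Y) ∧
        t a ∈ P a ∧ t a ∈ boundary G Y ∧ ∀ x ∈ P a, x ∈ boundary G Y → x = t a) ∧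
      ∀ a ∈ boundary G Y₀, ∀ b ∈ boundary G Y₀, a ≠ b → Disjoint (P a) (P b) := by
  induction n with
  | zero =>
    intro G Y Y₀ hY hcard hmin
    have : Y₀ = Y := Finset.Subset.antisymm
      (Finset.sdiff_eq_empty_iff_subset.1 (Finset.card_eq_zero.1 (Nat.le_zero.1 hcard))) hY
    subst this
    refine ⟨fun a => {a}, id, fun a ha => ⟨Conn.singleton G a, ?_⟩, ?_⟩
    · simp [ha]
    · simp
  | succ n ih =>
    intro G Y Y₀ hY hcard hmin
    by_cases hsub : boundary G Y₀ ⊆ boundary G Y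
    · refine ⟨fun a => {a}, id, fun a ha => ⟨Conn.singleton G a, ?_⟩, ?_⟩
      · simp [hsub ha]
      · simp
    by_cases hmid : ∃ Y₁, Y ⊂ Y₁ ∧ Y₁ ⊂ Y₀ ∧ (boundary G Y₁).card ≤ (boundary G Y₀).card
    · obtain ⟨Y₁, h1, h2, h3⟩ := hmid
      have hc1 : (Y₁ \ Y).card < (Y₀ \ Y).card := Finset.card_lt_card (by
        have := h1.1; have := h2.1; have := h2.2
        refine ⟨by grind, fun h => h2.2 fun x hx => ?_⟩
        by_cases hxY : x ∈ Y
        · exact h1.1 hxY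
        · exact (Finset.mem_sdiff.1 (h (Finset.mem_sdiff.2 ⟨hx, hxY⟩))).1)
      have hc2 : (Y₀ \ Y₁).card < (Y₀ \ Y).card := Finset.card_lt_card (by
        refine ⟨Finset.sdiff_subset_sdiff le_rfl h1.1, fun h => h1.2 fun x hx => ?_⟩
        by_contra hxY
        exact (Finset.mem_sdiff.1 (h (Finset.mem_sdiff.2 ⟨h2.1 hx, hxY⟩))).2 hx)
      obtain ⟨P, t, hP, hPd⟩ := ih G Y₁ Y₀ h2.1 (by omega)
        fun Y₂ h4 h5 => hmin Y₂ (h1.1.trans h4) h5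
      obtain ⟨Q, s, hQ, hQd⟩ := ih G Y Y₁ h1.1 (by omega)
        fun Y₂ h4 h5 => h3.trans (hmin Y₂ h4 (h5.trans h2.1))
      have hbd : ∀ x ∈ boundary G Y, x ∈ Y₁ ∨ x ∈ boundary G Y₁ := by
        intro x hx
        have := h1.1
        grind [mem_boundary]
      refine ⟨fun a => P a ∪ Q (t a), fun a => s (t a), fun a ha => ?_, ?_⟩
      · obtain ⟨p1, p2, p3, p4, p5, p6⟩ := hP a ha
        obtain ⟨q1, q2, q3, q4, q5, q6⟩ := hQ (t a) p5
        refine ⟨?_, by grind, ?_, by grind, q5, ?_⟩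
        · have := p1.biUnion (G := G) (φ := fun x => if x = t a then Q (t a) else {x})
            (fun x _ => by split_ifs; exacts [q1, Conn.singleton G x])
            (fun x hx y hy hxy => ⟨x, by split_ifs <;> grind, y, by split_ifs <;> grind, hxy⟩)
          convert this using 1
          ext x
          simp only [Finset.mem_union, Finset.mem_biUnion]
          constructor
          · rintro (h | h)
            · exact ⟨x, h, by split_ifs <;> grind⟩
            · exact ⟨t a, p4, by simpa using h⟩
          · rintro ⟨y, hy, hxy⟩
            split_ifs at hxy <;> grind
        · intro x hx
          have := h1.1
          have := h2.1
          have := p3 (t a) p4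
          have := mem_boundary.1 p5
          grind
        · intro x hx hxb
          rcases Finset.mem_union.1 hx with hx | hx
          · have hx1 : x ∈ boundary G Y₁ := by
              rcases hbd x hxb with h | h
              · rcases p3 x hx with rfl | h'
                · exact absurd (h2.1 h) (mem_boundary.1 ha).1
                · exact absurd h h'.2
              · exact h
            exact q6 x (p6 x hx hx1 ▸ q2) hxb
          · exact q6 x hx hxb
      · intro a ha b hb hab
        obtain ⟨p1, p2, p3, p4, p5, p6⟩ := hP a ha
        obtain ⟨q1, q2, q3, q4, q5, q6⟩ := hQ (t a) p5
        obtain ⟨p1', p2', p3', p4', p5', p6'⟩ := hP b hb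
        obtain ⟨q1', q2', q3', q4', q5', q6'⟩ := hQ (t b) p5'
        have hd := hPd a ha b hb hab
        have htt : t a ≠ t b := fun h => Finset.disjoint_left.1 hd p4 (h ▸ p4')
        have hd' := hQd _ p5 _ p5' htt
        have := h2.1
        have h8 := (mem_boundary.1 ha).1
        have h9 := (mem_boundary.1 hb).1
        rw [Finset.disjoint_left] at hd hd' ⊢
        intro x hx hx'
        rcases Finset.mem_union.1 hx with hx | hx <;> rcases Finset.mem_union.1 hx' with hx' | hx'
        · exact hd hx hx'
        · rcases q3' x hx' with rfl | h
          · exact hd hx p4'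
          · rcases p3 x hx with rfl | h'
            · exact h8 (this h.1)
            · exact h'.2 h.1
        · rcases q3 x hx with rfl | h
          · exact hd p4 hx'
          · rcases p3' x hx' with rfl | h'
            · exact h9 (this h.1)
            · exact h'.2 h.1
        · exact hd' hx hx'
    · push Not at hmid
      obtain ⟨a, ha, haY⟩ := Finset.not_subset.1 hsub
      obtain ⟨ha0, y, hy, hya⟩ := mem_boundary.1 ha
      have hyY : y ∉ Y := fun h => haY (mem_boundary.2 ⟨fun h' => ha0 (hY h'), y, h, hya⟩)
      let G₁ : SimpleGraph V := SimpleGraph.mk (fun p q => G.Adj p q ∧ p ≠ a ∧ q ≠ a)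
        ⟨fun p q h => ⟨h.1.symm, h.2.2, h.2.1⟩⟩ ⟨fun p h => G.loopless.irrefl p h.1⟩
      have hG₁ : ∀ p q, G₁.Adj p q ↔ G.Adj p q ∧ p ≠ a ∧ q ≠ a := fun p q => Iff.rfl
      have hsub1 : boundary G₁ (Y₀.erase y) ⊆ insert y ((boundary G Y₀).erase a) := by
        intro x hx
        simp only [Finset.mem_insert, Finset.mem_erase, mem_boundary, hG₁] at hx ⊢
        grind
      have hpos : 0 < (boundary G Y₀).card := Finset.card_pos.2 ⟨a, ha⟩
      have hcard1 : (insert y ((boundary G Y₀).erase a)).card ≤ (boundary G Y₀).card := by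
        have := Finset.card_insert_le y ((boundary G Y₀).erase a)
        rw [Finset.card_erase_of_mem ha] at this
        omega
      have hge : ∀ Y₁, Y ⊆ Y₁ → Y₁ ⊆ Y₀.erase y →
          (boundary G Y₀).card ≤ (boundary G₁ Y₁).card := by
        intro Y₁ h1 h2
        by_cases h3 : Y₁ = Y
        · subst h3
          refine (hmin Y₁ h1 hY).trans (Finset.card_le_card fun x hx => ?_)
          simp only [mem_boundary, hG₁] at hx haY ⊢
          grind
        · have h4 := hmid Y₁ ⟨h1, fun h => h3 (Finset.Subset.antisymm h h1)⟩
            ⟨fun x hx => Finset.mem_of_mem_erase (h2 hx), fun h => by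
              exact Finset.notMem_erase y Y₀ (h2 (h hy))⟩
          have h5 : boundary G Y₁ ⊆ insert a (boundary G₁ Y₁) := by
            intro x hx
            simp only [Finset.mem_insert, mem_boundary, hG₁] at hx ⊢
            grind
          have h6 := (Finset.card_le_card h5).trans (Finset.card_insert_le _ _)
          omega
      have heq := Finset.eq_of_subset_of_card_le hsub1
        (hcard1.trans (hge _ (by grind) le_rfl))
      have hc : (Y₀.erase y \ Y).card < (Y₀ \ Y).card := Finset.card_lt_card
        ⟨by grind, fun h => by
          have := h (Finset.mem_sdiff.2 ⟨hy, hyY⟩)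
          grind⟩
      obtain ⟨P, t, hP, hPd⟩ := ih G₁ Y (Y₀.erase y) (by grind) (by omega)
        fun Y₁ h1 h2 => (Finset.card_le_card hsub1).trans (hcard1.trans (hge Y₁ h1 h2))
      have hbY : ∀ x, x ∈ boundary G Y → x ∈ boundary G₁ Y := by
        intro x hx
        simp only [mem_boundary, hG₁] at hx haY ⊢
        grind
      have hbY' : ∀ x, x ∈ boundary G₁ Y → x ∈ boundary G Y := by
        intro x hx
        simp only [mem_boundary, hG₁] at hx ⊢
        grind
      have hbm : ∀ x ∈ boundary G Y₀, (if x = a then y else x) ∈ boundary G₁ (Y₀.erase y) := by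
        intro x hx
        rw [heq]
        split_ifs <;> grind
      have ha' : ∀ x ∈ boundary G₁ (Y₀.erase y), a ∉ P x := by
        intro x hx hax
        rcases (hP x hx).2.2.1 a hax with h | h
        · subst h
          rw [heq] at hx
          grind
        · grind
      refine ⟨fun x => if x = a then insert a (P y) else P x,
        fun x => t (if x = a then y else x), fun x hx => ?_, fun x hx x' hx' hne => ?_⟩
      · have hm := hbm x hx
        obtain ⟨p1, p2, p3, p4, p5, p6⟩ := hP _ hm
        by_cases hxa : x = a
        · subst hxa
          simp only [if_true] at *
          refine ⟨(p1.mono fun p q h => h.1).insert p2 hya.symm, by simp, ?_, by simp [p4],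
            hbY' _ p5, ?_⟩
          · grind
          · grind
        · simp only [hxa, if_false] at *
          refine ⟨p1.mono fun p q h => h.1, p2, ?_, p4, hbY' _ p5, ?_⟩
          · grind
          · grind
      · have hm := hbm x hx
        have hm' := hbm x' hx'
        have hy0 : y ∉ boundary G Y₀ := fun h => (mem_boundary.1 h).1 hy
        have hd := hPd _ hm _ hm' (by split_ifs <;> grind)
        have h1 := ha' _ hm
        have h2 := ha' _ hm'
        by_cases e : x = a
        · have e' : x' ≠ a := fun h => hne (e.trans h.symm)
          simp only [e, e', if_true, if_false] at hd h2 ⊢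
          exact Finset.disjoint_insert_left.2 ⟨h2, hd⟩
        · by_cases e' : x' = a
          · simp only [e, e', if_true, if_false] at hd h1 ⊢
            exact Finset.disjoint_insert_right.2 ⟨h1, hd⟩
          · simpa only [e, e', if_false] using hd

theorem boundary_subset_union (hY : Y ⊆ X) (hX : boundary G X ⊆ Z) : boundary G Y ⊆ X ∪ Z := by
  intro x hx
  obtain ⟨-, y, hy, hyx⟩ := mem_boundary.1 hx
  by_cases hxX : x ∈ X
  · exact Finset.mem_union_left _ hxX
  · exact Finset.mem_union_right _ (hX (mem_boundary.2 ⟨hxX, y, hY hy, hyx⟩))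

theorem disjoint_boundary (G : SimpleGraph V) (Y : Finset V) : Disjoint Y (boundary G Y) :=
  Finset.disjoint_right.2 fun _ hx => (mem_boundary.1 hx).1

theorem Massed.boundary_eq (h : Massed G X Z) : boundary G X = Z := by
  refine Finset.eq_of_subset_of_card_le h.bdry (not_lt.1 fun hlt => ?_)
  have := h.sparse X le_rfl hlt
  have := h.dense
  omega

theorem Massed.nonempty (h : Massed G X Z) : X.Nonempty := by
  by_contra hX
  have hd := h.dense
  have : darts G X = ∅ := by
    ext p
    simp [mem_darts, Finset.not_nonempty_iff_eq_empty.1 hX]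
  simp [this] at hd

theorem Massed.or_exists (hdisj : Disjoint X Z) (hb : boundary G X ⊆ Z) (hc : Z.card ≤ 4)
    (hd : 8 * X.card < (darts G X).card) :
    Massed G X Z ∨ ∃ Y ⊆ X, (boundary G Y).card < Z.card ∧ Massed G Y (boundary G Y) := by
  by_cases hs : ∀ Y ⊆ X, (boundary G Y).card < Z.card → (darts G Y).card ≤ 8 * Y.card
  · exact .inl ⟨hdisj, hb, hc, hd, hs⟩
  right
  push Not at hs
  obtain ⟨Y, hYX, hYZ, hY⟩ := hs
  obtain ⟨Y', hY', hmin⟩ := Finset.exists_min_image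
    (X.powerset.filter fun Y => 8 * Y.card < (darts G Y).card) (fun Y => (boundary G Y).card)
    ⟨Y, by simp [hYX, hY]⟩
  simp only [Finset.mem_filter, Finset.mem_powerset] at hY' hmin
  have hlt := (hmin Y ⟨hYX, hY⟩).trans_lt hYZ
  refine ⟨Y', hY'.1, hlt, disjoint_boundary G Y', le_rfl, by omega, hY'.2, fun Y₁ h1 h2 => ?_⟩
  by_contra h3
  have := hmin Y₁ ⟨h1.trans hY'.1, not_le.1 h3⟩
  omega

/-- In a minimal counterexample no part that can be separated from `Z` by fewer than `|Z|`
vertices carries a complete model rooted at its boundary. -/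
theorem Massed.not_hasClique (hM : Massed G X Z)
    (ih : ∀ (G' : SimpleGraph V) (X' Z' : Finset V), X'.card < X.card → Massed G' X' Z' →
      HasModel G' X' Z')
    (hno : ¬ HasModel G X Z) (hYX : Y ⊆ X) (hne : Y.Nonempty)
    (hlt : (boundary G Y).card < Z.card) : ¬ HasClique G Y (boundary G Y) := by
  intro hcl
  obtain ⟨Y₀, hY₀, hmax⟩ := Finset.exists_max_image
    (X.powerset.filter fun Y => Y.Nonempty ∧ (boundary G Y).card < Z.card ∧
      HasClique G Y (boundary G Y)) Finset.card ⟨Y, by simp [hYX, hne, hlt, hcl]⟩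
  clear hYX hne hlt hcl
  simp only [Finset.mem_filter, Finset.mem_powerset] at hY₀ hmax
  obtain ⟨hYX, hne, hlt, hcl⟩ := hY₀
  set N := boundary G Y₀ with hN
  have hNXZ : N ⊆ X ∪ Z := boundary_subset_union hYX hM.bdry
  let G' : SimpleGraph V := SimpleGraph.mk
    (fun p q => p ≠ q ∧ p ∉ Y₀ ∧ q ∉ Y₀ ∧ (G.Adj p q ∨ p ∈ N ∧ q ∈ N))
    ⟨fun p q h => ⟨h.1.symm, h.2.2.1, h.2.1, h.2.2.2.imp (fun h => h.symm) And.symm⟩⟩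
    ⟨fun p h => h.1 rfl⟩
  have hG' : ∀ p q, G'.Adj p q ↔ p ≠ q ∧ p ∉ Y₀ ∧ q ∉ Y₀ ∧ (G.Adj p q ∨ p ∈ N ∧ q ∈ N) :=
    fun _ _ => Iff.rfl
  have hXc : (X \ Y₀).card + Y₀.card = X.card := Finset.card_sdiff_add_card_eq_card hYX
  have hYpos := hne.card_pos
  have hdense : 8 * (X \ Y₀).card < (darts G' (X \ Y₀)).card := by
    have hs : darts G X ⊆ darts G Y₀ ∪ darts G' (X \ Y₀) := by
      rintro ⟨p, q⟩ h
      simp only [Finset.mem_union, mem_darts, hG', Finset.mem_sdiff] at h ⊢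
      have := h.1.ne
      tauto
    have h1 := (Finset.card_le_card hs).trans (Finset.card_union_le _ _)
    have h2 := hM.sparse Y₀ hYX hlt
    have h3 := hM.dense
    omega
  have hb' : boundary G' (X \ Y₀) ⊆ Z := by
    intro x hx
    simp only [mem_boundary, hG', Finset.mem_sdiff] at hx
    obtain ⟨hx1, y, hy, hxy, hy', hxY, h⟩ := hx
    rcases h with h | h
    · exact hM.bdry (mem_boundary.2 ⟨fun hxX => hx1 ⟨hxX, hxY⟩, y, hy.1, h⟩)
    · exact (Finset.mem_union.1 (hNXZ h.2)).resolve_left fun hxX => hx1 ⟨hxX, hxY⟩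
  rcases Massed.or_exists (G := G') (hM.disj.mono_left Finset.sdiff_subset) hb' hM.card_le hdense
    with hM' | ⟨Y', hY'X, hY'Z, hM'⟩
  · exact hno ((ih G' _ Z (by omega) hM').of_clique hcl (fun x y h => ((hG' x y).1 h).2.2.2)
      Finset.disjoint_sdiff (hM.disj.mono_left hYX) hYX Finset.sdiff_subset le_rfl)
  · have hY'Y₀ : ∀ y ∈ Y', y ∉ Y₀ := fun y hy => (Finset.mem_sdiff.1 (hY'X hy)).2
    by_cases hYN : ∃ y ∈ Y', y ∈ N
    · obtain ⟨y₀, hy₀, hy₀N⟩ := hYN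
      have hsub : boundary G (Y₀ ∪ Y') ⊆ boundary G' Y' := by
        intro x hx
        simp only [mem_boundary, hG', Finset.mem_union, not_or] at hx ⊢
        obtain ⟨⟨hx1, hx2⟩, y, hy, hyx⟩ := hx
        rcases hy with hy | hy
        · exact ⟨hx2, y₀, hy₀, fun h => hx2 (h ▸ hy₀), hY'Y₀ _ hy₀, hx1,
            .inr ⟨hy₀N, mem_boundary.2 ⟨hx1, y, hy, hyx⟩⟩⟩
        · exact ⟨hx2, y, hy, hyx.ne, hY'Y₀ _ hy, hx1, .inl hyx⟩
      have hle := Finset.card_le_card hsub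
      have hmodel : HasModel G (Y₀ ∪ Y') (boundary G (Y₀ ∪ Y')) :=
        (ih G' _ _ (by have := Finset.card_le_card hY'X; omega) hM').of_clique hcl
          (fun x y h => ((hG' x y).1 h).2.2.2) (Finset.disjoint_right.2 hY'Y₀)
          (Finset.disjoint_right.2 fun x hx => by
            obtain ⟨-, y, -, h⟩ := mem_boundary.1 hx
            exact h.2.2.1) Finset.subset_union_left Finset.subset_union_right hsub
      have hc4 := hM.card_le
      have := hmax (Y₀ ∪ Y') ⟨Finset.union_subset hYX (hY'X.trans Finset.sdiff_subset),
        hne.mono Finset.subset_union_left, by omega, hmodel.hasClique (by omega)⟩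
      have := Finset.card_lt_card (Finset.ssubset_iff_subset_ne.2
        ⟨Finset.subset_union_left (s₁ := Y₀) (s₂ := Y'), fun h => hY'Y₀ y₀ hy₀
          (h ▸ Finset.mem_union_right _ hy₀)⟩)
      omega
    · push Not at hYN
      have h1 : boundary G Y' ⊆ boundary G' Y' := by
        intro x hx
        simp only [mem_boundary, hG'] at hx ⊢
        obtain ⟨hx1, y, hy, hyx⟩ := hx
        exact ⟨hx1, y, hy, hyx.ne, hY'Y₀ y hy, fun hx2 => hYN y hy
          (mem_boundary.2 ⟨hY'Y₀ y hy, x, hx2, hyx.symm⟩), .inl hyx⟩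
      have h2 : darts G' Y' ⊆ darts G Y' := by
        rintro ⟨p, q⟩ h
        simp only [mem_darts, hG'] at h ⊢
        have := hYN p
        have := hYN q
        tauto
      have h3 := hM.sparse Y' (hY'X.trans Finset.sdiff_subset)
        ((Finset.card_le_card h1).trans_lt hY'Z)
      have h4 := Finset.card_le_card h2
      have h5 := hM'.dense
      omega

/-- To refute a minimal counterexample, it suffices to build models on the sets containing
`Y` that are well linked to `Y`. -/
theorem Massed.false_of_forall (hM : Massed G X Z)
    (ih : ∀ (G' : SimpleGraph V) (X' Z' : Finset V), X'.card < X.card → Massed G' X' Z' →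
      HasModel G' X' Z')
    (hno : ¬ HasModel G X Z) (hYX : Y ⊆ X) (hne : Y.Nonempty)
    (h : ∀ (Y₀ : Finset V) (P : V → Finset V) (t : V → V), Y ⊆ Y₀ → Y₀ ⊆ X →
      (boundary G Y₀).card ≤ Z.card →
      (∀ a ∈ boundary G Y₀, Conn G (P a) ∧ a ∈ P a ∧ (∀ x ∈ P a, x = a ∨ x ∈ Y₀ ∧ x ∉ Y) ∧
        t a ∈ P a ∧ t a ∈ boundary G Y ∧ ∀ x ∈ P a, x ∈ boundary G Y → x = t a) →
      (∀ a ∈ boundary G Y₀, ∀ b ∈ boundary G Y₀, a ≠ b → Disjoint (P a) (P b)) →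
      HasModel G Y₀ (boundary G Y₀)) : False := by
  obtain ⟨Y₀, hY₀, hmin⟩ := Finset.exists_min_image
    (X.powerset.filter fun Y₀ => Y ⊆ Y₀) (fun Y => (boundary G Y).card) ⟨X, by simp [hYX]⟩
  simp only [Finset.mem_filter, Finset.mem_powerset] at hY₀ hmin
  have key : ∀ Y₀, Y ⊆ Y₀ → Y₀ ⊆ X →
      (∀ Y₁, Y ⊆ Y₁ → Y₁ ⊆ Y₀ → (boundary G Y₀).card ≤ (boundary G Y₁).card) →
      (boundary G Y₀).card ≤ Z.card → HasModel G Y₀ (boundary G Y₀) := by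
    intro Y₀ h1 h2 h3 h4
    obtain ⟨P, t, hP, hPd⟩ := exists_linkage _ G Y Y₀ h1 le_rfl h3
    exact h Y₀ P t h1 h2 h4 hP hPd
  have hle := hmin X ⟨le_rfl, hYX⟩
  rw [hM.boundary_eq] at hle
  have hc4 := hM.card_le
  rcases hle.lt_or_eq with hlt | heq
  · exact hM.not_hasClique ih hno hY₀.1 (hne.mono hY₀.2) hlt
      ((key Y₀ hY₀.2 hY₀.1 (fun Y₁ h1 h2 => hmin Y₁ ⟨h2.trans hY₀.1, h1⟩) hle).hasClique (by omega))
  · have := key X hYX le_rfl (fun Y₁ h1 h2 => by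
      have := hmin Y₁ ⟨h2, h1⟩
      rw [hM.boundary_eq]
      omega) (by rw [hM.boundary_eq])
    rw [hM.boundary_eq] at this
    exact hno this

/-- In a minimal counterexample, few edges meet any proper part of `X` that can be separated
from `Z` by at most `|Z|` vertices. -/
theorem Massed.darts_le (hM : Massed G X Z)
    (ih : ∀ (G' : SimpleGraph V) (X' Z' : Finset V), X'.card < X.card → Massed G' X' Z' →
      HasModel G' X' Z')
    (hno : ¬ HasModel G X Z) (hYX : Y ⊆ X) (hne : Y ≠ X)
    (hle : (boundary G Y).card ≤ Z.card) : (darts G Y).card ≤ 8 * Y.card := by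
  rcases hle.lt_or_eq with hlt | heq
  · exact hM.sparse Y hYX hlt
  by_contra hd
  have hMY : Massed G Y (boundary G Y) :=
    ⟨disjoint_boundary G Y, le_rfl, heq.trans_le hM.card_le, not_le.1 hd, fun Y₁ h1 h2 =>
      hM.sparse Y₁ (h1.trans hYX) (heq ▸ h2)⟩
  have hmodel := ih G Y _ (Finset.card_lt_card (hYX.ssubset_of_ne hne)) hMY
  refine hM.false_of_forall ih hno hYX hMY.nonempty fun Y₀ P t h1 h2 h3 hP hPd => ?_
  have htinj : ∀ a ∈ boundary G Y₀, ∀ b ∈ boundary G Y₀, t a = t b → a = b := by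
    intro a ha b hb hab
    by_contra hne
    exact Finset.disjoint_left.1 (hPd a ha b hb hne) (hP a ha).2.2.2.1 (hab ▸ (hP b hb).2.2.2.1)
  have hnot : ∀ a ∈ boundary G Y₀, ∀ x ∈ P a, x ∉ Y := by
    intro a ha x hx hxY
    rcases (hP a ha).2.2.1 x hx with rfl | h
    · exact (mem_boundary.1 ha).1 (h1 hxY)
    · exact h.2 hxY
  let φ : V → Finset V := fun x =>
    if h : ∃ a ∈ boundary G Y₀, t a = x then P h.choose else {x}
  have hφt : ∀ a ∈ boundary G Y₀, φ (t a) = P a := by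
    intro a ha
    have h : ∃ b ∈ boundary G Y₀, t b = t a := ⟨a, ha, rfl⟩
    simp only [φ, dif_pos h]
    rw [htinj _ h.choose_spec.1 a ha h.choose_spec.2]
  have hφn : ∀ x, (¬ ∃ a ∈ boundary G Y₀, t a = x) → φ x = {x} := fun x h => dif_neg h
  have hφmem : ∀ x, x ∈ φ x := by
    intro x
    by_cases h : ∃ a ∈ boundary G Y₀, t a = x
    · obtain ⟨a, ha, rfl⟩ := h
      rw [hφt a ha]
      exact (hP a ha).2.2.2.1
    · simp [hφn x h]
  have hφY : ∀ x ∈ Y, φ x = {x} := fun x hx => hφn x (by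
    rintro ⟨a, ha, rfl⟩
    exact (mem_boundary.1 (hP a ha).2.2.2.2.1).1 hx)
  have hYbd : ∀ x, x ∈ Y ∨ x ∈ boundary G Y → ∀ a ∈ boundary G Y₀, x ∈ P a → x = t a := by
    rintro x (hx | hx) a ha hxa
    · exact absurd hx (hnot a ha x hxa)
    · exact (hP a ha).2.2.2.2.2 x hxa hx
  refine hmodel.lift (φ := φ) (r := t) ⟨?_, ?_, ?_, ?_, ?_, htinj, ?_, ?_⟩
  · intro x _
    by_cases h : ∃ a ∈ boundary G Y₀, t a = x
    · obtain ⟨a, ha, rfl⟩ := h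
      rw [hφt a ha]
      exact (hP a ha).1
    · rw [hφn x h]
      exact Conn.singleton G x
  · intro x y hx hy hxy
    by_cases h : ∃ a ∈ boundary G Y₀, t a = x
    · obtain ⟨a, ha, rfl⟩ := h
      rw [hφt a ha]
      by_cases h' : ∃ b ∈ boundary G Y₀, t b = y
      · obtain ⟨b, hb, rfl⟩ := h'
        rw [hφt b hb]
        exact hPd a ha b hb fun h => hxy (h ▸ rfl)
      · rw [hφn y h', Finset.disjoint_singleton_right]
        exact fun hya => hxy (hYbd y hy a ha hya).symm
    · rw [hφn x h, Finset.disjoint_singleton_left]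
      intro hxφ
      by_cases h' : ∃ b ∈ boundary G Y₀, t b = y
      · obtain ⟨b, hb, rfl⟩ := h'
        rw [hφt b hb] at hxφ
        exact hxy (hYbd x hx b hb hxφ)
      · rw [hφn y h', Finset.mem_singleton] at hxφ
        exact hxy hxφ
  · intro x y _ _ hxy
    exact ⟨x, hφmem x, y, hφmem y, hxy⟩
  · intro x hx
    rw [hφY x hx, Finset.singleton_subset_iff]
    exact h1 hx
  · exact fun a ha => (hP a ha).2.2.2.2.1
  · intro a ha
    rw [hφt a ha]
    exact (hP a ha).2.1
  · intro a ha x hx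
    rw [hφt a ha] at hx
    exact ((hP a ha).2.2.1 x hx).imp_right fun h => h.1

/-- In a minimal counterexample every edge meeting `X` lies in at least four triangles, where
`Z` is regarded as a clique. -/
theorem Massed.four_le_card (hM : Massed G X Z)
    (ih : ∀ (G' : SimpleGraph V) (X' Z' : Finset V), X'.card < X.card → Massed G' X' Z' →
      HasModel G' X' Z')
    (hno : ¬ HasModel G X Z) {u v : V} (hu : u ∈ X) (huv : G.Adj u v) :
    4 ≤ (Finset.univ.filter fun x =>
      G.Adj u x ∧ x ≠ v ∧ (G.Adj x v ∨ x ∈ Z ∧ v ∈ Z)).card := by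
  by_contra hcn
  have hne := huv.ne
  have hXZ : ∀ x, G.Adj u x → x ∈ X ∨ x ∈ Z := fun x hx => by
    by_cases h : x ∈ X
    · exact .inl h
    · exact .inr (hM.bdry (mem_boundary.2 ⟨h, u, hu, hx⟩))
  let G' : SimpleGraph V := SimpleGraph.mk
    (fun p q => p ≠ q ∧ p ≠ u ∧ q ≠ u ∧ (G.Adj p q ∨ (p = v ∧ G.Adj u q) ∨ (q = v ∧ G.Adj u p)))
    ⟨fun p q h => ⟨h.1.symm, h.2.2.1, h.2.1, h.2.2.2.imp (fun h => h.symm) Or.symm⟩⟩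
    ⟨fun p h => h.1 rfl⟩
  have hG' : ∀ p q, G'.Adj p q ↔ p ≠ q ∧ p ≠ u ∧ q ≠ u ∧
    (G.Adj p q ∨ (p = v ∧ G.Adj u q) ∨ (q = v ∧ G.Adj u p)) := fun _ _ => Iff.rfl
  have hXc : (X.erase u).card + 1 = X.card := Finset.card_erase_add_one hu
  have hdense : 8 * (X.erase u).card < (darts G' (X.erase u)).card := by
    set T := Finset.univ.filter fun x => G.Adj u x ∧ x ≠ v ∧ (G.Adj x v ∨ x ∈ Z ∧ v ∈ Z) with hT
    set S := Finset.univ.filter fun x => G.Adj u x ∧ x ≠ v ∧ ¬ (G.Adj x v ∨ x ∈ Z ∧ v ∈ Z) with hS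
    set N := Finset.univ.filter fun x => G.Adj u x with hN
    set D := (darts G X).filter fun p => p.1 ≠ u ∧ p.2 ≠ u with hD
    have hN1 : N ⊆ S ∪ insert v T := by
      intro x hx
      simp only [hN, hS, hT, Finset.mem_filter, Finset.mem_univ, true_and, Finset.mem_union,
        Finset.mem_insert] at hx ⊢
      tauto
    have hN2 : N.card ≤ S.card + (T.card + 1) := (Finset.card_le_card hN1).trans
      ((Finset.card_union_le _ _).trans (Nat.add_le_add_left (Finset.card_insert_le _ _) _))
    have h1 : darts G X ⊆ (D ∪ N.image fun x => (u, x)) ∪ N.image fun x => (x, u) := by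
      rintro ⟨p, q⟩ h
      have := h
      simp only [hD, hN, Finset.mem_union, Finset.mem_filter, Finset.mem_image, Finset.mem_univ,
        true_and, mem_darts, Prod.mk.injEq] at h ⊢
      by_cases hp : p = u
      · subst hp
        exact .inl (.inr ⟨q, h.1, rfl, rfl⟩)
      by_cases hq : q = u
      · subst hq
        exact .inr ⟨p, h.1.symm, rfl, rfl⟩
      exact .inl (.inl ⟨h, hp, hq⟩)
    have h2 : (D ∪ S.image fun x => (v, x)) ∪ (S.image fun x => (x, v)) ⊆
        darts G' (X.erase u) := by
      rintro ⟨p, q⟩ h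
      simp only [hD, hS, Finset.mem_union, Finset.mem_filter, Finset.mem_image, Finset.mem_univ,
        true_and, mem_darts, Prod.mk.injEq, Finset.mem_erase, hG'] at h ⊢
      rcases h with (h | ⟨x, h, rfl, rfl⟩) | ⟨x, h, rfl, rfl⟩
      · have := h.1.1.ne
        tauto
      · have := hXZ _ h.1
        have := hXZ _ huv
        have := h.1.ne
        grind
      · have := hXZ _ h.1
        have := hXZ _ huv
        have := h.1.ne
        grind
    have h3 := Finset.card_le_card h2
    rw [Finset.card_union_of_disjoint, Finset.card_union_of_disjoint,
      Finset.card_image_of_injective _ (Prod.mk_right_injective v),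
      Finset.card_image_of_injective _ (Prod.mk_left_injective v)] at h3
    · have h4 := (Finset.card_le_card h1).trans (Finset.card_union_le _ _)
      have h5 := Finset.card_union_le D (N.image fun x => (u, x))
      have h6 : (N.image fun x => (u, x)).card ≤ N.card := Finset.card_image_le
      have h7 : (N.image fun x => (x, u)).card ≤ N.card := Finset.card_image_le
      have h8 := hM.dense
      omega
    · rw [Finset.disjoint_left]
      rintro ⟨p, q⟩ h h'
      simp only [hD, hS, Finset.mem_filter, Finset.mem_image, Finset.mem_univ,
        true_and, mem_darts, Prod.mk.injEq] at h h'
      obtain ⟨x, h', rfl, rfl⟩ := h'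
      exact h'.2.2 (.inl h.1.1.symm)
    · rw [Finset.disjoint_left]
      rintro ⟨p, q⟩ h h'
      simp only [hD, hS, Finset.mem_filter, Finset.mem_image, Finset.mem_univ, Finset.mem_union,
        true_and, mem_darts, Prod.mk.injEq] at h h'
      obtain ⟨x, h', rfl, rfl⟩ := h'
      rcases h with h | ⟨y, h, rfl, rfl⟩
      · exact h'.2.2 (.inl h.1.1)
      · exact h.2.1 rfl
  have hb' : boundary G' (X.erase u) ⊆ Z := by
    intro x hx
    simp only [mem_boundary, hG', Finset.mem_erase] at hx
    obtain ⟨hx1, y, hy, hyx, hyu, hxu, h⟩ := hx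
    have hxX : x ∉ X := fun h => hx1 ⟨hxu, h⟩
    rcases h with h | h | h
    · exact hM.bdry (mem_boundary.2 ⟨hxX, y, hy.2, h⟩)
    · exact (hXZ x h.2).resolve_left hxX
    · exact (hXZ x (h.1 ▸ huv)).resolve_left hxX
  have hlift : ∀ X' Z' X₁ Z₁, X' ⊆ X₁ → u ∈ X₁ → u ∉ X' → u ∉ Z' → Z₁ ⊆ Z' →
      HasModel G' X' Z' → HasModel G X₁ Z₁ := by
    intro X' Z' X₁ Z₁ hX hu₁ huX huZ hZ h
    have hself : ∀ x, x ∈ if x = v then {u, v} else ({x} : Finset V) := by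
      intro x
      split_ifs with h <;> simp [h]
    have hu' : ∀ x, x ∈ X' ∨ x ∈ Z' → x ≠ u := by
      rintro x hx rfl
      exact hx.elim huX huZ
    refine h.lift (φ := fun x => if x = v then {u, v} else {x}) (r := id)
      ⟨?_, ?_, ?_, ?_, fun z hz => hZ hz, fun _ _ _ _ h => h, fun z _ => hself z, ?_⟩
    · intro x _
      split_ifs
      · exact (Conn.singleton G v).insert (Finset.mem_singleton_self v) huv
      · exact Conn.singleton G x
    · intro x y hx hy hxy
      have := hu' x hx
      have := hu' y hy
      rw [Finset.disjoint_left]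
      intro w h1 h2
      split_ifs at h1 h2 <;> grind
    · intro x y hx hy hxy
      rcases hxy.2.2.2 with h | h | h
      · exact ⟨x, hself x, y, hself y, h⟩
      · exact ⟨u, by simp [h.1], y, hself y, h.2⟩
      · exact ⟨x, hself x, u, by simp [h.1], h.2.symm⟩
    · intro x hx y hy
      have := hX hx
      split_ifs at hy <;> grind
    · intro z hz x hx
      dsimp only [id] at hx
      split_ifs at hx <;> grind
  have huZ : u ∉ Z := Finset.disjoint_left.1 hM.disj hu
  rcases Massed.or_exists (G := G') (hM.disj.mono_left (Finset.erase_subset _ _)) hb' hM.card_le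
    hdense with hM' | ⟨Y, hYX, hYZ, hM'⟩
  · exact hno (hlift _ _ _ _ (Finset.erase_subset _ _) hu (Finset.notMem_erase u X) huZ le_rfl
      (ih G' _ Z (by omega) hM'))
  have huY : u ∉ Y := fun h => Finset.notMem_erase u X (hYX h)
  have hYX' : Y ⊆ X := hYX.trans (Finset.erase_subset _ _)
  by_cases hvY : v ∈ Y
  · have hsub : boundary G (insert u Y) ⊆ boundary G' Y := by
      intro x hx
      simp only [mem_boundary, hG', Finset.mem_insert, not_or] at hx ⊢
      obtain ⟨⟨hx1, hx2⟩, y, hy, hyx⟩ := hx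
      rcases hy with rfl | hy
      · exact ⟨hx2, v, hvY, fun h => hx2 (h ▸ hvY), hne.symm, hx1, .inr (.inl ⟨rfl, hyx⟩)⟩
      · exact ⟨hx2, y, hy, hyx.ne, fun h => huY (h ▸ hy), hx1, .inl hyx⟩
    have hle := Finset.card_le_card hsub
    have hc4 := hM.card_le
    have hm : HasModel G (insert u Y) (boundary G (insert u Y)) :=
      hlift _ _ _ _ (Finset.subset_insert _ _) (Finset.mem_insert_self _ _) huY
        (fun h => by
          obtain ⟨-, y, -, h⟩ := mem_boundary.1 h
          exact h.2.2.1 rfl) hsub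
        (ih G' _ _ (by have := Finset.card_le_card hYX; omega) hM')
    exact hM.not_hasClique ih hno (Finset.insert_subset hu hYX') (Finset.insert_nonempty u Y)
      (by omega) (hm.hasClique (by omega))
  · have hb : boundary G Y ⊆ insert u (boundary G' Y) := by
      intro x hx
      simp only [mem_boundary, hG', Finset.mem_insert] at hx ⊢
      obtain ⟨hx1, y, hy, hyx⟩ := hx
      by_cases hxu : x = u
      · exact .inl hxu
      · exact .inr ⟨hx1, y, hy, hyx.ne, fun h => huY (h ▸ hy), hxu, .inl hyx⟩
    have hbc := (Finset.card_le_card hb).trans (Finset.card_insert_le _ _)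
    have hd := hM.darts_le ih hno hYX' (fun h => huY (h ▸ hu)) (by omega)
    have hinj : (darts G' Y).card ≤ (darts G Y).card := by
      refine Finset.card_le_card_of_injOn
        (fun p => if G.Adj p.1 p.2 then p else if p.1 = v then (u, p.2) else (p.1, u)) ?_ ?_
      · rintro ⟨p, q⟩ h
        simp only [Finset.mem_coe, mem_darts, hG'] at h ⊢
        split_ifs with h1 h2
        · exact ⟨h1, h.2⟩
        · dsimp only at h1 h2 ⊢
          grind
        · dsimp only at h1 h2 ⊢
          have := G.adj_comm u p
          grind
      · rintro ⟨p, q⟩ h ⟨p', q'⟩ h' heq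
        simp only [Finset.mem_coe, mem_darts, hG'] at h h' heq
        split_ifs at heq <;> simp only [Prod.mk.injEq] at heq ⊢ <;> grind
    have := hM'.dense
    omega

theorem Massed.mem_or_mem (hM : Massed G X Z) {u x : V} (hu : u ∈ X) (hx : G.Adj u x) :
    x ∈ X ∨ x ∈ Z := by
  by_cases h : x ∈ X
  · exact .inl h
  · exact .inr (hM.bdry (mem_boundary.2 ⟨h, u, hu, hx⟩))

theorem Massed.exists_adj (hM : Massed G X Z)
    (ih : ∀ (G' : SimpleGraph V) (X' Z' : Finset V), X'.card < X.card → Massed G' X' Z' →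
      HasModel G' X' Z')
    (hno : ¬ HasModel G X Z) : ∃ u ∈ X, ∃ w ∈ X, G.Adj u w := by
  have hd := hM.dense
  obtain ⟨⟨p, q⟩, hpq⟩ := Finset.card_pos.1 (pos_of_gt hd)
  obtain ⟨u, hu, v, huv⟩ : ∃ u ∈ X, ∃ v, G.Adj u v := by
    rcases mem_darts.1 hpq with ⟨h, h' | h'⟩
    · exact ⟨p, h', q, h⟩
    · exact ⟨q, h', p, h.symm⟩
  by_contra! hcon
  have hv : v ∈ Z := (hM.mem_or_mem hu huv).resolve_left fun h => hcon u hu v h huv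
  have h4 := hM.four_le_card ih hno hu huv
  have hs : (Finset.univ.filter fun x => G.Adj u x ∧ x ≠ v ∧ (G.Adj x v ∨ x ∈ Z ∧ v ∈ Z)) ⊆
      Z.erase v := by
    intro x hx
    simp only [Finset.mem_filter, Finset.mem_univ, true_and, Finset.mem_erase] at hx ⊢
    exact ⟨hx.2.1, (hM.mem_or_mem hu hx.1).resolve_left fun h => hcon u hu x h hx.1⟩
  have h1 := Finset.card_le_card hs
  rw [Finset.card_erase_of_mem hv] at h1
  have := hM.card_le
  omega

theorem Massed.darts_card_le (hM : Massed G X Z)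
    (ih : ∀ (G' : SimpleGraph V) (X' Z' : Finset V), X'.card < X.card → Massed G' X' Z' →
      HasModel G' X' Z')
    (ih' : ∀ G' : SimpleGraph V, (darts G' X).card < (darts G X).card → Massed G' X Z →
      HasModel G' X Z)
    (hno : ¬ HasModel G X Z) : (darts G X).card ≤ 8 * X.card + 2 := by
  by_contra hbig
  obtain ⟨u, hu, w, hw, huw⟩ := hM.exists_adj ih hno
  let G' : SimpleGraph V := SimpleGraph.mk
    (fun p q => G.Adj p q ∧ ¬ (p = u ∧ q = w) ∧ ¬ (p = w ∧ q = u))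
    ⟨fun p q h => ⟨h.1.symm, fun h' => h.2.2 h'.symm, fun h' => h.2.1 h'.symm⟩⟩
    ⟨fun p h => G.loopless.irrefl p h.1⟩
  have hG' : ∀ p q, G'.Adj p q ↔ G.Adj p q ∧ ¬ (p = u ∧ q = w) ∧ ¬ (p = w ∧ q = u) :=
    fun _ _ => Iff.rfl
  have hsub : ∀ Y, darts G' Y ⊆ darts G Y := by
    intro Y p h
    simp only [mem_darts, hG'] at h ⊢
    exact ⟨h.1.1, h.2⟩
  have hlt : (darts G' X).card < (darts G X).card := by
    refine Finset.card_lt_card ⟨hsub X, fun h => ?_⟩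
    have := h (mem_darts.2 ⟨huw, .inl hu⟩ : (u, w) ∈ darts G X)
    simp only [mem_darts, hG'] at this
    tauto
  refine hno ((ih' G' hlt ⟨hM.disj, ?_, hM.card_le, ?_, ?_⟩).mono_of_adj fun x y h => h.1)
  · intro x hx
    simp only [mem_boundary, hG'] at hx
    obtain ⟨hx1, y, hy, h⟩ := hx
    exact hM.bdry (mem_boundary.2 ⟨hx1, y, hy, h.1⟩)
  · have h1 : darts G X ⊆ insert (u, w) (insert (w, u) (darts G' X)) := by
      rintro ⟨p, q⟩ h
      simp only [Finset.mem_insert, Prod.mk.injEq, mem_darts, hG'] at h ⊢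
      tauto
    have := Finset.card_le_card h1
    have := Finset.card_insert_le (u, w) (insert (w, u) (darts G' X))
    have := Finset.card_insert_le (w, u) (darts G' X)
    omega
  · intro Y hYX hYZ
    have hYne : Y ≠ X := by
      rintro rfl
      have h1 : boundary G Y ⊆ boundary G' Y := by
        intro x hx
        simp only [mem_boundary, hG'] at hx ⊢
        grind
      have := Finset.card_le_card h1
      rw [hM.boundary_eq] at this
      omega
    have hb : ∃ x, boundary G Y ⊆ insert x (boundary G' Y) := by
      by_cases h : w ∈ Y
      · refine ⟨u, fun x hx => ?_⟩
        simp only [Finset.mem_insert, mem_boundary, hG'] at hx ⊢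
        grind
      · refine ⟨w, fun x hx => ?_⟩
        simp only [Finset.mem_insert, mem_boundary, hG'] at hx ⊢
        grind
    obtain ⟨x, hx⟩ := hb
    have := (Finset.card_le_card hx).trans (Finset.card_insert_le _ _)
    exact (Finset.card_le_card (hsub Y)).trans
      (hM.darts_le ih hno hYX hYne (by omega))

theorem mem_boundary_singleton {v x : V} : x ∈ boundary G {v} ↔ G.Adj v x := by
  simp only [mem_boundary, Finset.mem_singleton, exists_eq_left, and_iff_right_iff_imp]
  exact fun h => h.ne'

theorem sum_card_boundary_le (G : SimpleGraph V) (X : Finset V) :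
    ∑ v ∈ X, (boundary G {v}).card ≤ (darts G X).card := by
  rw [← Finset.card_sigma]
  refine Finset.card_le_card_of_injOn (fun p => (p.1, p.2)) ?_ ?_
  · rintro ⟨v, x⟩ h
    simp only [Finset.mem_coe, Finset.mem_sigma, mem_boundary_singleton, mem_darts] at h ⊢
    exact ⟨h.2, .inl h.1⟩
  · rintro ⟨v, x⟩ - ⟨v', x'⟩ - h
    simp only [Prod.mk.injEq] at h
    rw [h.1, h.2]

theorem Massed.boundary_nonempty (hM : Massed G X Z)
    (ih : ∀ (G' : SimpleGraph V) (X' Z' : Finset V), X'.card < X.card → Massed G' X' Z' →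
      HasModel G' X' Z')
    (hno : ¬ HasModel G X Z) {v : V} (hv : v ∈ X) : (boundary G {v}).Nonempty := by
  by_contra hN
  have hN' : ∀ x, ¬ G.Adj v x := fun x hx => hN ⟨x, mem_boundary_singleton.2 hx⟩
  have hc := Finset.card_erase_add_one hv
  refine hno ((ih G (X.erase v) Z (by omega) ⟨hM.disj.mono_left (Finset.erase_subset _ _), ?_,
    hM.card_le, ?_, fun Y hY => hM.sparse Y (hY.trans (Finset.erase_subset _ _))⟩).mono_left
    (Finset.erase_subset _ _))
  · intro x hx
    simp only [mem_boundary, Finset.mem_erase] at hx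
    obtain ⟨hx1, y, hy, hyx⟩ := hx
    refine hM.bdry (mem_boundary.2 ⟨fun h => hx1 ⟨?_, h⟩, y, hy.2, hyx⟩)
    rintro rfl
    exact hN' _ hyx.symm
  · have h1 : darts G X ⊆ darts G (X.erase v) := by
      rintro ⟨p, q⟩ h
      simp only [mem_darts, Finset.mem_erase] at h ⊢
      refine ⟨h.1, h.2.imp (fun h' => ⟨?_, h'⟩) fun h' => ⟨?_, h'⟩⟩
      · rintro rfl
        exact hN' _ h.1
      · rintro rfl
        exact hN' _ h.1.symm
    have := Finset.card_le_card h1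
    have := hM.dense
    omega

theorem Massed.exists_card_boundary_le (hM : Massed G X Z)
    (hd : (darts G X).card ≤ 8 * X.card + 2) : ∃ v ∈ X, (boundary G {v}).card ≤ 8 := by
  by_contra! hcon
  have h1 := (Finset.card_nsmul_le_sum X _ 9 hcon).trans (sum_card_boundary_le G X)
  rw [smul_eq_mul] at h1
  obtain ⟨v, hv⟩ := hM.nonempty
  have h2 : boundary G {v} ⊆ X.erase v ∪ Z := by
    intro x hx
    rw [mem_boundary_singleton] at hx
    rw [Finset.mem_union, Finset.mem_erase]
    exact (hM.mem_or_mem hv hx).imp_left fun h => ⟨hx.ne', h⟩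
  have h3 := (Finset.card_le_card h2).trans (Finset.card_union_le _ _)
  have h4 := Finset.card_erase_add_one hv
  have := hcon v hv
  have := hM.card_le
  omega

/-- A vertex of small degree all of whose incident edges lie in many triangles yields a model on
every set that is well linked to it. -/
theorem hasModel_of_linkage {Y₀ : Finset V} {v : V} {P : V → Finset V} {t : V → V} (hv : v ∈ Y₀)
    (hYZ : Disjoint Y₀ Z) (hS : (boundary G Y₀).card ≤ 4) (hN : (boundary G {v}).Nonempty)
    (hN8 : (boundary G {v}).card ≤ 8)
    (hcommon : ∀ y, G.Adj v y → 4 ≤ (Finset.univ.filter fun x =>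
      G.Adj v x ∧ x ≠ y ∧ (G.Adj x y ∨ x ∈ Z ∧ y ∈ Z)).card)
    (hP : ∀ a ∈ boundary G Y₀, Conn G (P a) ∧ a ∈ P a ∧
      (∀ x ∈ P a, x = a ∨ x ∈ Y₀ ∧ x ∉ ({v} : Finset V)) ∧ t a ∈ P a ∧
      t a ∈ boundary G {v} ∧ ∀ x ∈ P a, x ∈ boundary G {v} → x = t a)
    (hPd : ∀ a ∈ boundary G Y₀, ∀ b ∈ boundary G Y₀, a ≠ b → Disjoint (P a) (P b)) :
    HasModel G Y₀ (boundary G Y₀) := by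
  set N := boundary G {v} with hNdef
  have hNmem : ∀ x, x ∈ N ↔ G.Adj v x := fun x => mem_boundary_singleton
  have hN4 : 4 ≤ N.card := by
    obtain ⟨y, hy⟩ := hN
    refine (hcommon y ((hNmem y).1 hy)).trans (Finset.card_le_card fun x hx => ?_)
    exact (hNmem x).2 (Finset.mem_filter.1 hx).2.1
  obtain ⟨T, hT₀, hTN, hT⟩ := Finset.exists_subsuperset_card_eq
    (s := (boundary G Y₀).image t) (t := N) (n := 4)
    (Finset.image_subset_iff.2 fun a ha => (hP a ha).2.2.2.2.1)
    (Finset.card_image_le.trans hS) hN4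
  have htT : ∀ a ∈ boundary G Y₀, t a ∈ T := fun a ha => hT₀ (Finset.mem_image_of_mem t ha)
  have hRc : (N \ T).card ≤ 4 := by
    have := Finset.card_sdiff_add_card_eq_card hTN
    omega
  have hTR : T ∪ N \ T = N := Finset.union_sdiff_of_subset hTN
  have hRP : ∀ a ∈ boundary G Y₀, ∀ x ∈ P a, x ∉ N \ T := by
    intro a ha x hx hxR
    rw [Finset.mem_sdiff] at hxR
    exact hxR.2 ((hP a ha).2.2.2.2.2 x hx hxR.1 ▸ htT a ha)
  have hRY : N \ T ⊆ Y₀ := by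
    intro x hx
    by_contra hxY
    have hxS : x ∈ boundary G Y₀ :=
      mem_boundary.2 ⟨hxY, v, hv, (hNmem x).1 (Finset.mem_sdiff.1 hx).1⟩
    exact hRP x hxS x (hP x hxS).2.1 hx
  have hRZ : ∀ x ∈ N \ T, x ∉ Z := fun x hx => Finset.disjoint_left.1 hYZ (hRY hx)
  have hvP : ∀ a ∈ boundary G Y₀, v ∉ P a := by
    intro a ha hva
    rcases (hP a ha).2.2.1 v hva with rfl | h
    · exact (mem_boundary.1 ha).1 hv
    · simp at h
  have hvR : v ∉ N \ T := fun h => G.loopless.irrefl v ((hNmem v).1 (Finset.mem_sdiff.1 h).1)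
  have hdeg : ∀ r ∈ N \ T, 4 ≤ ((T ∪ N \ T).filter fun x => G.Adj r x).card := by
    intro r hr
    refine (hcommon r ((hNmem r).1 (Finset.mem_sdiff.1 hr).1)).trans
      (Finset.card_le_card fun x hx => ?_)
    have := hRZ r hr
    simp only [hTR, Finset.mem_filter, Finset.mem_univ, true_and] at hx ⊢
    exact ⟨(hNmem x).2 hx.1, (hx.2.2.resolve_right fun h => this h.2).symm⟩
  have hadj : ∀ s ∈ T, ∃ r ∈ N \ T, G.Adj s r := by
    intro s hs
    by_contra! hcon
    have h1 := hcommon s ((hNmem s).1 (hTN hs))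
    have h2 : (Finset.univ.filter fun x =>
        G.Adj v x ∧ x ≠ s ∧ (G.Adj x s ∨ x ∈ Z ∧ s ∈ Z)) ⊆ T.erase s := by
      intro x hx
      simp only [Finset.mem_filter, Finset.mem_univ, true_and, Finset.mem_erase] at hx ⊢
      refine ⟨hx.2.1, ?_⟩
      by_contra hxT
      have hxR : x ∈ N \ T := Finset.mem_sdiff.2 ⟨(hNmem x).2 hx.1, hxT⟩
      rcases hx.2.2 with h | h
      · exact hcon x hxR h.symm
      · exact hRZ x hxR h.1
    have h3 := Finset.card_le_card h2
    rw [Finset.card_erase_of_mem hs] at h3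
    omega
  rcases exists_dominating hT hRc hdeg hadj with
    ⟨D, hD, hDc, hdom⟩ | ⟨r₁, hr₁, r₂, hr₂, hr, t₀, ht₀, hdom⟩
  · refine ⟨P, {v}, D, ⟨fun a ha => (hP a ha).1, fun a ha => (hP a ha).2.1,
      fun a ha x hx => ((hP a ha).2.2.1 x hx).imp_right fun h => h.1, hPd⟩, Conn.singleton G v, hDc,
      Finset.singleton_subset_iff.2 hv, hD.trans hRY, ?_, ?_, fun a ha => ⟨?_, ?_, ?_, ?_⟩⟩
    · exact Finset.disjoint_singleton_left.2 fun h => hvR (hD h)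
    · obtain ⟨d, hd⟩ := hDc.1
      exact ⟨v, by simp, d, hd, (hNmem d).1 (Finset.mem_sdiff.1 (hD hd)).1⟩
    · exact Finset.disjoint_singleton_right.2 (hvP a ha)
    · exact Finset.disjoint_left.2 fun x hx hxD => hRP a ha x hx (hD hxD)
    · exact ⟨t a, (hP a ha).2.2.2.1, v, by simp, ((hNmem _).1 (hP a ha).2.2.2.2.1).symm⟩
    · obtain ⟨d, hd, h⟩ := hdom (t a) (htT a ha)
      exact ⟨t a, (hP a ha).2.2.2.1, d, hd, h⟩
  · have hmem : ∀ a x, (x ∈ if t a = t₀ then insert v (P a) else P a) ↔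
        x ∈ P a ∨ x = v ∧ t a = t₀ := by
      intro a x
      split_ifs with h <;> simp [h, or_comm]
    have hinj : ∀ a ∈ boundary G Y₀, ∀ b ∈ boundary G Y₀, t a = t b → a = b := by
      intro a ha b hb hab
      by_contra hne
      exact Finset.disjoint_left.1 (hPd a ha b hb hne) (hP a ha).2.2.2.1
        (hab ▸ (hP b hb).2.2.2.1)
    have hvr : ∀ r ∈ N \ T, G.Adj v r := fun r hr => (hNmem r).1 (Finset.mem_sdiff.1 hr).1
    have htouch : ∀ a ∈ boundary G Y₀, ∀ r ∈ N \ T, (∀ s ∈ T, s ≠ t₀ → G.Adj s r) →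
        Touch G (if t a = t₀ then insert v (P a) else P a) {r} := by
      intro a ha r hr h
      by_cases hta : t a = t₀
      · exact ⟨v, (hmem a v).2 (.inr ⟨rfl, hta⟩), r, by simp, hvr r hr⟩
      · exact ⟨t a, (hmem a _).2 (.inl (hP a ha).2.2.2.1), r, by simp, h _ (htT a ha) hta⟩
    have hdisj : ∀ a ∈ boundary G Y₀, ∀ r ∈ N \ T,
        Disjoint (if t a = t₀ then insert v (P a) else P a) {r} := by
      intro a ha r hr
      rw [Finset.disjoint_singleton_right, hmem]
      rintro (h | ⟨rfl, -⟩)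
      · exact hRP a ha r h hr
      · exact hvR hr
    refine ⟨fun a => if t a = t₀ then insert v (P a) else P a, {r₁}, {r₂}, ⟨?_, ?_, ?_, ?_⟩,
      Conn.singleton G r₁, Conn.singleton G r₂, Finset.singleton_subset_iff.2 (hRY hr₁),
      Finset.singleton_subset_iff.2 (hRY hr₂), ?_, ⟨r₁, by simp, r₂, by simp, hr⟩, fun a ha =>
      ⟨hdisj a ha r₁ hr₁, hdisj a ha r₂ hr₂, htouch a ha r₁ hr₁ fun s hs h => (hdom s hs h).1,
        htouch a ha r₂ hr₂ fun s hs h => (hdom s hs h).2⟩⟩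
    · intro a ha
      split_ifs
      · exact (hP a ha).1.insert (hP a ha).2.2.2.1 ((hNmem _).1 (hP a ha).2.2.2.2.1)
      · exact (hP a ha).1
    · exact fun a ha => (hmem a a).2 (.inl (hP a ha).2.1)
    · intro a ha x hx
      rcases (hmem a x).1 hx with h | ⟨rfl, -⟩
      · exact ((hP a ha).2.2.1 x h).imp_right fun h => h.1
      · exact .inr hv
    · intro a ha b hb hab
      rw [Finset.disjoint_left]
      intro x hx hx'
      rcases (hmem a x).1 hx with h | ⟨rfl, h⟩ <;> rcases (hmem b _).1 hx' with h' | ⟨h'', h'⟩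
      · exact Finset.disjoint_left.1 (hPd a ha b hb hab) h h'
      · exact hvP a ha (h'' ▸ h)
      · exact hvP b hb h'
      · exact hab (hinj a ha b hb (h.trans h'.symm))
    · simpa using hr.ne

theorem Massed.hasModel_of_minimal (hM : Massed G X Z)
    (ih : ∀ (G' : SimpleGraph V) (X' Z' : Finset V), X'.card < X.card → Massed G' X' Z' →
      HasModel G' X' Z')
    (ih' : ∀ G' : SimpleGraph V, (darts G' X).card < (darts G X).card → Massed G' X Z →
      HasModel G' X Z) : HasModel G X Z := by
  by_contra hno
  obtain ⟨v, hv, hv8⟩ := hM.exists_card_boundary_le (hM.darts_card_le ih ih' hno)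
  refine hM.false_of_forall ih hno (Finset.singleton_subset_iff.2 hv)
    (Finset.singleton_nonempty v) fun Y₀ P t h1 h2 h3 hP hPd => ?_
  exact hasModel_of_linkage (Finset.singleton_subset_iff.1 h1) (hM.disj.mono_left h2)
    (h3.trans hM.card_le) (hM.boundary_nonempty ih hno hv) hv8
    (fun y hy => hM.four_le_card ih hno hv hy) hP hPd

theorem Massed.hasModel (hM : Massed G X Z) : HasModel G X Z := by
  suffices h : ∀ n m (G : SimpleGraph V) (X Z : Finset V), X.card = n → (darts G X).card = m →
      Massed G X Z → HasModel G X Z from h _ _ G X Z rfl rfl hM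
  intro n
  induction n using Nat.strong_induction_on with
  | _ n ihn =>
    intro m
    induction m using Nat.strong_induction_on with
    | _ m ihm =>
      intro G X Z hn hm hM
      exact hM.hasModel_of_minimal (fun G' X' Z' h hM' => ihn _ (hn ▸ h) _ G' X' Z' rfl rfl hM')
        fun G' h hM' => ihm _ (hm ▸ h) G' X Z hn rfl hM'

end

end RootedModel

/-- if `|Z| = 4`, `(G,Z)` is internally 4-connected and `G` has no
`Z`-rooted `K*₄,₂`-model, then `|E(G)| ≤ 4|V(G)| - 10`. -/
theorem statement_5 (V : Type) [Fintype V] (G : SimpleGraph V) (Z : Set V)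
    (hZ : Z.ncard = 4) (hic : InternallyConnected G Z 4)
    (h : ¬ HasRootedK42starModel G Z) :
    (G.edgeSet.ncard : ℤ) ≤ 4 * (Fintype.card V : ℤ) - 10 := by
  classical
  by_contra hlt
  push Not at hlt
  have hZc : Z.toFinset.card = 4 := by rw [← Set.ncard_eq_toFinset_card', hZ]
  have hXc : Z.toFinsetᶜ.card = Fintype.card V - 4 := by rw [Finset.card_compl, hZc]
  have hn : 4 ≤ Fintype.card V := hZc ▸ Finset.card_le_univ _
  have hE : G.edgeSet.ncard = G.edgeFinset.card := by
    rw [← coe_edgeFinset, Set.ncard_coe_finset]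
  have hM : RootedModel.Massed G Z.toFinsetᶜ Z.toFinset := by
    refine ⟨disjoint_compl_left, fun x hx => ?_, hZc.le, ?_, fun Y hY hYZ => ?_⟩
    · simpa using (RootedModel.mem_boundary.1 hx).1
    · have h1 : (Finset.univ.sigma fun v => G.neighborFinset v).card ≤
          (RootedModel.darts G Z.toFinsetᶜ ∪ Z.toFinset.offDiag).card := by
        refine Finset.card_le_card_of_injOn (fun p => (p.1, p.2)) ?_ ?_
        · rintro ⟨v, x⟩ hvx
          have hvx' : G.Adj v x := by simpa using hvx
          simp only [Finset.mem_coe, Finset.mem_union, RootedModel.mem_darts,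
            Finset.mem_offDiag, Finset.mem_compl]
          have := hvx'.ne
          tauto
        · rintro ⟨v, x⟩ - ⟨v', x'⟩ - hvx
          simp only [Prod.mk.injEq] at hvx
          rw [hvx.1, hvx.2]
      rw [Finset.card_sigma] at h1
      simp only [card_neighborFinset_eq_degree, sum_degrees_eq_twice_card_edges] at h1
      have h2 := Finset.card_union_le (RootedModel.darts G Z.toFinsetᶜ) Z.toFinset.offDiag
      rw [Finset.offDiag_card, hZc] at h2
      omega
    · rcases Y.eq_empty_or_nonempty with rfl | hne
      · have : RootedModel.darts G ∅ = ∅ := by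
          ext p
          simp [RootedModel.mem_darts]
        simp [this]
      · exfalso
        obtain ⟨y, hy⟩ := hne
        have h4 := hic (Y : Set V)ᶜ (Y ∪ RootedModel.boundary G Y) ⟨?_, ?_⟩ ?_ ⟨y, by simp [hy]⟩
        · have hAB : ((Y : Set V)ᶜ ∩ (Y ∪ RootedModel.boundary G Y)) =
              (RootedModel.boundary G Y : Set V) := by
            ext x
            simp only [Set.mem_inter_iff, Set.mem_compl_iff, Set.mem_union, Finset.mem_coe,
              RootedModel.mem_boundary]
            tauto
          rw [hAB, Set.ncard_coe_finset] at h4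
          omega
        · ext x
          simp only [Set.mem_union, Set.mem_compl_iff, Finset.mem_coe, Set.mem_univ, iff_true]
          tauto
        · rintro u w huw ⟨⟨hu1, hu2⟩, hw1, hw2⟩
          simp only [Set.mem_compl_iff, Finset.mem_coe, Set.mem_union, not_or, not_not] at *
          exact hu2.2 (RootedModel.mem_boundary.2 ⟨hu1, w, hw2, huw.symm⟩)
        · intro z hz hzY
          have := hY hzY
          simp [hz] at this
  obtain ⟨B, C, D, hB, hC, hD, hCX, hDX, hCD, htCD, hroot⟩ := hM.hasModel
  have e : Fin 4 ≃ Z.toFinset := (Z.toFinset.equivFinOfCardEq hZc).symm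
  refine h ⟨fun i => B (e i), ![C, D], fun i => (hB.conn _ (e i).2).connected_induce, ?_,
    fun i j hij => ?_, ?_, ?_, fun i => ?_, fun z hz => ?_, fun i => ?_, ?_⟩
  · simp only [Fin.forall_fin_two]
    exact ⟨hC.connected_induce, hD.connected_induce⟩
  · exact Finset.disjoint_coe.2 (hB.disj _ (e i).2 _ (e j).2 fun hij' =>
      hij (e.injective (Subtype.ext hij')))
  · simp [Fin.forall_fin_two, hCD, hCD.symm]
  · simp only [Fin.forall_fin_two]
    exact fun i => ⟨Finset.disjoint_coe.2 (hroot _ (e i).2).1,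
      Finset.disjoint_coe.2 (hroot _ (e i).2).2.1⟩
  · refine ⟨e i, ⟨Set.mem_toFinset.1 (e i).2, hB.root _ (e i).2⟩, fun y hy => ?_⟩
    refine (hB.sub _ (e i).2 y hy.2).resolve_right fun hyX => ?_
    simp [hy.1] at hyX
  · refine ⟨e.symm ⟨z, by simpa using hz⟩, ?_⟩
    simpa using hB.root z (by simpa using hz)
  · simp only [Fin.forall_fin_two]
    exact ⟨(hroot _ (e i).2).2.2.1, (hroot _ (e i).2).2.2.2⟩
  · exact htCD
end

section
/- Let G be a 4-connected graph with |E(G)| ≥ 4|V(G)| − 8 that has no K7^∨-minor and is not isomorphic to K_{2,2,2,2}. Then |V(G)| ≥ 9. -/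
open SimpleGraph

/-- Seven pairwise disjoint connected bags, all pairs of which are adjacent except possibly
two pairs sharing a bag, form a model of `K7vee`. -/
theorem isMinor_K7vee_of_bags {V : Type} [DecidableEq V] (G : SimpleGraph V) (t : Finset V)
    (ht : t.card = 7) (bag : V → Set V)
    (hconn : ∀ a ∈ t, (G.induce (bag a)).Connected)
    (hdisj : ∀ a ∈ t, ∀ b ∈ t, a ≠ b → Disjoint (bag a) (bag b))
    (x y z : V) (hx : x ∈ t) (hy : y ∈ t) (hz : z ∈ t)
    (hadj : ∀ a ∈ t, ∀ b ∈ t, a ≠ b → s(a, b) ≠ s(x, y) → s(a, b) ≠ s(x, z) →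
      ∃ u ∈ bag a, ∃ v ∈ bag b, G.Adj u v) :
    IsMinor K7vee G := by
  obtain ⟨S, hyz, hS, hcard⟩ := Finset.exists_subsuperset_card_eq
    (s := ({y, z} : Finset V).erase x) (t := t.erase x) (n := 2)
    (by intro a; grind)
    ((Finset.card_le_card (Finset.erase_subset _ _)).trans Finset.card_le_two)
    (by rw [Finset.card_erase_of_mem hx]; omega)
  obtain ⟨y', z', hne, rfl⟩ := Finset.card_eq_two.mp hcard
  obtain ⟨g, hg⟩ := Finset.exists_equiv_extend_of_card_eq (α := Fin 7) (t := t)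
    (s := {0, 1, 2}) (f := ![x, y', z', x, x, x, x]) (by simp [ht])
    (by
      intro a ha
      simp at ha
      have h1 := @hS y' (by simp)
      have h2 := @hS z' (by simp)
      grind)
    (by
      have h1 := @hS y' (by simp)
      have h2 := @hS z' (by simp)
      intro i hi j hj hij
      simp at hi hj
      rcases hi with rfl | rfl | rfl <;> rcases hj with rfl | rfl | rfl <;> simp at hij ⊢ <;> grind)
  have h0 : (g 0 : V) = x := hg 0 (by simp)
  have h1 : (g 1 : V) = y' := hg 1 (by simp)
  have h2 : (g 2 : V) = z' := hg 2 (by simp)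
  have hyy : y ≠ x → y = y' ∨ y = z' := fun h => by simpa using @hyz y (by simp [h])
  have hzz : z ≠ x → z = y' ∨ z = z' := fun h => by simpa using @hyz z (by simp [h])
  have hinj : ∀ i j, (g i : V) = g j → i = j := fun i j h => g.injective (Subtype.ext h)
  refine ⟨fun i => bag (g i), fun i => hconn _ (g i).2,
    fun i j hij => hdisj _ (g i).2 _ (g j).2 fun h => hij (hinj i j h), fun i j hij => ?_⟩
  have hK : i ≠ j ∧ s(i, j) ≠ s(0, 1) ∧ s(i, j) ≠ s(0, 2) := by
    simpa [K7vee, SimpleGraph.deleteEdges_adj] using hij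
  obtain ⟨hij, hK1, hK2⟩ := hK
  have hgne : (g i : V) ≠ g j := fun h => hij (hinj i j h)
  have key : ∀ w, w = x ∨ w = y' ∨ w = z' → s((g i : V), (g j : V)) ≠ s(x, w) := by
    intro w hw h
    rw [Sym2.eq_iff] at h
    rw [Ne, Sym2.eq_iff] at hK1 hK2
    grind
  exact hadj _ (g i).2 _ (g j).2 hgne (key y (by grind)) (key z (by grind))

/-- If deleting a vertex `c` of a graph on eight vertices leaves only nonedges among
`xy`, `xz`, then there is a `K7vee`-minor. -/
theorem isMinor_K7vee_of_delete {V : Type} [Fintype V] [DecidableEq V] (G : SimpleGraph V)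
    (hV : Fintype.card V = 8) (c x y z : V) (hx : x ≠ c) (hy : y ≠ c) (hz : z ≠ c)
    (hadj : ∀ a b, a ≠ c → b ≠ c → a ≠ b → s(a, b) ≠ s(x, y) → s(a, b) ≠ s(x, z) →
      G.Adj a b) :
    IsMinor K7vee G := by
  refine isMinor_K7vee_of_bags G (Finset.univ.erase c) (by simp [hV]) (fun a => {a})
    (fun a _ => SimpleGraph.Connected.of_subsingleton) (fun a _ b _ h => by simpa using h)
    x y z (by simpa) (by simpa) (by simpa) fun a ha b hb hab h1 h2 => ?_
  exact ⟨a, rfl, b, rfl, hadj a b (by simpa using ha) (by simpa using hb) hab h1 h2⟩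

/-- If contracting an edge `cu` of a graph on eight vertices leaves only nonedges among
`xy`, `xz`, then there is a `K7vee`-minor. -/
theorem isMinor_K7vee_of_contract {V : Type} [Fintype V] [DecidableEq V] (G : SimpleGraph V)
    (hV : Fintype.card V = 8) (c u x y z : V) (hcu : G.Adj u c)
    (hx : x ≠ c) (hy : y ≠ c) (hz : z ≠ c)
    (hadj : ∀ a b, a ≠ c → b ≠ c → a ≠ b → s(a, b) ≠ s(x, y) → s(a, b) ≠ s(x, z) →
      G.Adj a b ∨ (a = u ∧ G.Adj c b) ∨ (b = u ∧ G.Adj c a)) :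
    IsMinor K7vee G := by
  refine isMinor_K7vee_of_bags G (Finset.univ.erase c) (by simp [hV])
    (fun a => {w | w = a ∨ (a = u ∧ w = c)}) (fun a _ => ?_) (fun a ha b hb h => ?_)
    x y z (by simpa) (by simpa) (by simpa) fun a ha b hb hab h1 h2 => ?_
  · by_cases h : a = u
    · have : {w | w = a ∨ (a = u ∧ w = c)} = {u, c} := by ext w; simp [h]
      rw [this]
      exact SimpleGraph.induce_pair_connected_of_adj hcu
    · have : {w | w = a ∨ (a = u ∧ w = c)} = {a} := by ext w; simp [h]
      rw [this]
      exact SimpleGraph.Connected.of_subsingleton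
  · rw [Set.disjoint_left]
    simp at ha hb
    simp only [Set.mem_ofPred_eq]
    grind
  · rcases hadj a b (by simpa using ha) (by simpa using hb) hab h1 h2 with h | ⟨h, hc⟩ | ⟨h, hc⟩
    · exact ⟨a, .inl rfl, b, .inl rfl, h⟩
    · exact ⟨c, .inr ⟨h, rfl⟩, b, .inl rfl, hc⟩
    · exact ⟨a, .inl rfl, c, .inr ⟨h, rfl⟩, hc.symm⟩

/-- A graph on eight vertices whose nonedges lie among four pairs, two of which share a
vertex, has a `K7vee`-minor. -/
theorem isMinor_K7vee_of_incident_nonedges {V : Type} [Fintype V] [DecidableEq V]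
    (G : SimpleGraph V) (hV : Fintype.card V = 8) (x y z a b c d : V)
    (hxy : x ≠ y) (hxz : x ≠ z) (hyz : y ≠ z) (hab : a ≠ b) (hcd : c ≠ d)
    (hadj : ∀ v w, v ≠ w → s(v, w) ≠ s(x, y) → s(v, w) ≠ s(x, z) → s(v, w) ≠ s(a, b) →
      s(v, w) ≠ s(c, d) → G.Adj v w) :
    IsMinor K7vee G := by
  simp only [ne_eq, Sym2.eq_iff] at hadj
  by_cases hxab : x = a ∨ x = b
  · by_cases hxcd : x = c ∨ x = d
    · refine isMinor_K7vee_of_delete G hV x y y y (by grind) (by grind) (by grind) ?_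
      simp only [ne_eq, Sym2.eq_iff]
      grind
    · refine isMinor_K7vee_of_delete G hV x c d d (by grind) (by grind) (by grind) ?_
      simp only [ne_eq, Sym2.eq_iff]
      grind
  by_cases hxcd : x = c ∨ x = d
  · refine isMinor_K7vee_of_delete G hV x a b b (by grind) (by grind) (by grind) ?_
    simp only [ne_eq, Sym2.eq_iff]
    grind
  by_cases hshare : a = c ∨ a = d ∨ b = c ∨ b = d
  · obtain ⟨p, q, r, hp, hq, hr, h1, h2⟩ : ∃ p q r, p ≠ x ∧ q ≠ x ∧ r ≠ x ∧
        s(a, b) = s(p, q) ∧ s(c, d) = s(p, r) := by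
      simp only [Sym2.eq_iff]
      rcases hshare with h | h | h | h
      · exact ⟨a, b, d, by grind⟩
      · exact ⟨a, b, c, by grind⟩
      · exact ⟨b, a, d, by grind⟩
      · exact ⟨b, a, c, by grind⟩
    refine isMinor_K7vee_of_delete G hV x p q r hp hq hr ?_
    simp only [ne_eq, Sym2.eq_iff] at h1 h2 ⊢
    grind
  by_cases hab' : y ≠ a ∧ y ≠ b ∧ z ≠ a ∧ z ≠ b
  · refine isMinor_K7vee_of_contract G hV x a c d d (by apply hadj <;> grind)
      (by grind) (by grind) (by grind) ?_
    simp only [ne_eq, Sym2.eq_iff]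
    grind
  by_cases hcd' : y ≠ c ∧ y ≠ d ∧ z ≠ c ∧ z ≠ d
  · refine isMinor_K7vee_of_contract G hV x c a b b (by apply hadj <;> grind)
      (by grind) (by grind) (by grind) ?_
    simp only [ne_eq, Sym2.eq_iff]
    grind
  obtain ⟨r, hr, hzr⟩ : ∃ r, r ≠ y ∧ ((y = a ∨ y = b) ∧ s(c, d) = s(z, r) ∨
      (y = c ∨ y = d) ∧ s(a, b) = s(z, r)) := by
    simp only [Sym2.eq_iff]
    have hz : z = a ∨ z = b ∨ z = c ∨ z = d := by grind
    rcases hz with h | h | h | h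
    · exact ⟨b, by grind⟩
    · exact ⟨a, by grind⟩
    · exact ⟨d, by grind⟩
    · exact ⟨c, by grind⟩
  refine isMinor_K7vee_of_delete G hV y z x r (by grind) (by grind) (by grind) ?_
  simp only [ne_eq, Sym2.eq_iff] at hzr ⊢
  grind

/-- A graph on eight vertices whose nonedges lie among three pairwise disjoint pairs has a
`K7vee`-minor. -/
theorem isMinor_K7vee_of_three_disjoint_nonedges {V : Type} [Fintype V] [DecidableEq V]
    (G : SimpleGraph V) (hV : Fintype.card V = 8) (a b c d e f : V)
    (hnodup : [a, b, c, d, e, f].Nodup)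
    (hadj : ∀ v w, v ≠ w → s(v, w) ≠ s(a, b) → s(v, w) ≠ s(c, d) → s(v, w) ≠ s(e, f) →
      G.Adj v w) :
    IsMinor K7vee G := by
  simp only [ne_eq, Sym2.eq_iff] at hadj
  simp at hnodup
  refine isMinor_K7vee_of_contract G hV a c e f f (by apply hadj <;> grind)
    (by grind) (by grind) (by grind) ?_
  simp only [ne_eq, Sym2.eq_iff]
  grind

/-- A graph on eight vertices whose nonedges form a perfect matching is `K2222`. -/
theorem nonempty_iso_K2222_of_perfect_matching_nonedges {V : Type} [Fintype V]
    (G : SimpleGraph V) (hV : Fintype.card V = 8) (a b c d e f g h : V)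
    (hnodup : [a, b, c, d, e, f, g, h].Nodup)
    (hadj : ∀ v w, G.Adj v w ↔ v ≠ w ∧ s(v, w) ≠ s(a, b) ∧ s(v, w) ≠ s(c, d) ∧
      s(v, w) ≠ s(e, f) ∧ s(v, w) ≠ s(g, h)) :
    Nonempty (G ≃g K2222) := by
  simp only [ne_eq, Sym2.eq_iff] at hadj
  simp at hnodup
  let F : Fin 4 × Fin 2 → V := fun p => ![![a, b], ![c, d], ![e, f], ![g, h]] p.1 p.2
  have hinj : Function.Injective F := by
    rintro ⟨i, k⟩ ⟨j, l⟩ hF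
    fin_cases i <;> fin_cases k <;> fin_cases j <;> fin_cases l <;> simp [F] at hF ⊢ <;> grind
  have hbij : Function.Bijective F :=
    (Fintype.bijective_iff_injective_and_card F).mpr ⟨hinj, by simp [hV]⟩
  refine ⟨(RelIso.symm ⟨Equiv.ofBijective F hbij, ?_⟩)⟩
  rintro ⟨i, k⟩ ⟨j, l⟩
  rw [Equiv.ofBijective_apply, Equiv.ofBijective_apply, hadj]
  fin_cases i <;> fin_cases k <;> fin_cases j <;> fin_cases l <;> simp [F, K2222] <;> grind

/-- A graph with at most `n` nonedges is complete outside some set of exactly `n` pairs. -/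
theorem exists_card_eq_nonedges_subset {V : Type} [Fintype V] [DecidableEq V]
    (G : SimpleGraph V) (n : ℕ) (hn : n ≤ (Fintype.card V).choose 2)
    (hG : (Fintype.card V).choose 2 ≤ G.edgeSet.ncard + n) :
    ∃ T : Finset (Sym2 V), T.card = n ∧ (∀ v w, s(v, w) ∈ T → v ≠ w) ∧
      ∀ v w, v ≠ w → s(v, w) ∉ T → G.Adj v w := by
  classical
  have hcard : ((⊤ : SimpleGraph V).edgeFinset \ G.edgeFinset).card ≤ n := by
    rw [Finset.card_sdiff_of_subset (SimpleGraph.edgeFinset_mono le_top),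
      SimpleGraph.card_edgeFinset_top_eq_card_choose_two, SimpleGraph.edgeFinset,
      ← Set.ncard_eq_toFinset_card']
    omega
  obtain ⟨T, hT, hT', hTn⟩ := Finset.exists_subsuperset_card_eq
    (Finset.sdiff_subset (s := (⊤ : SimpleGraph V).edgeFinset) (t := G.edgeFinset)) hcard
    (by rwa [SimpleGraph.card_edgeFinset_top_eq_card_choose_two])
  refine ⟨T, hTn, fun v w h => by simpa using hT' h, fun v w hvw h => ?_⟩
  by_contra hG
  exact h (hT (by simp [hvw, hG]))

theorem isMinor_K7vee_of_card_eq_seven {V : Type} [Fintype V] (G : SimpleGraph V)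
    (hV : Fintype.card V = 7) (hedge : 20 ≤ G.edgeSet.ncard) : IsMinor K7vee G := by
  classical
  obtain ⟨T, hT, -, hadj⟩ := exists_card_eq_nonedges_subset G 1 (by simp [hV, Nat.choose])
    (by simp [hV, Nat.choose]; omega)
  obtain ⟨p, rfl⟩ := Finset.card_eq_one.mp hT
  induction p using Sym2.ind with
  | _ x y =>
  refine isMinor_K7vee_of_bags G Finset.univ (by simp [hV]) (fun a => {a})
    (fun a _ => SimpleGraph.Connected.of_subsingleton) (fun a _ b _ h => by simpa using h)
    x y y (by simp) (by simp) (by simp) fun a _ b _ hab h1 _ => ?_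
  exact ⟨a, rfl, b, rfl, hadj a b hab (by simpa using h1)⟩

theorem isMinor_K7vee_or_iso_K2222_of_card_eq_eight {V : Type} [Fintype V] (G : SimpleGraph V)
    (hV : Fintype.card V = 8) (hedge : 24 ≤ G.edgeSet.ncard) :
    IsMinor K7vee G ∨ Nonempty (G ≃g K2222) := by
  classical
  obtain ⟨T, hT, hdiag, hadj⟩ := exists_card_eq_nonedges_subset G 4 (by simp [hV, Nat.choose])
    (by simp [hV, Nat.choose]; omega)
  by_cases hP : ∃ x y z, y ≠ z ∧ s(x, y) ∈ T ∧ s(x, z) ∈ T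
  · left
    obtain ⟨x, y, z, hyz, hxy, hxz⟩ := hP
    have hne : s(x, z) ≠ s(x, y) := fun h => hyz (Sym2.congr_right.mp h).symm
    have hxz' : s(x, z) ∈ T.erase s(x, y) := Finset.mem_erase.mpr ⟨hne, hxz⟩
    have h2 : ((T.erase s(x, y)).erase s(x, z)).card = 2 := by
      rw [Finset.card_erase_of_mem hxz', Finset.card_erase_of_mem hxy, hT]
    obtain ⟨p, q, -, hpq⟩ := Finset.card_eq_two.mp h2
    induction p using Sym2.ind with
    | _ a b =>
    induction q using Sym2.ind with
    | _ c d =>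
    have hab : s(a, b) ∈ (T.erase s(x, y)).erase s(x, z) := by simp [hpq]
    have hcd : s(c, d) ∈ (T.erase s(x, y)).erase s(x, z) := by simp [hpq]
    refine isMinor_K7vee_of_incident_nonedges G hV x y z a b c d (hdiag _ _ hxy)
      (hdiag _ _ hxz) hyz (hdiag _ _ (Finset.mem_of_mem_erase (Finset.mem_of_mem_erase hab)))
      (hdiag _ _ (Finset.mem_of_mem_erase (Finset.mem_of_mem_erase hcd))) ?_
    intro v w hvw h1 h2 h3 h4
    refine hadj v w hvw fun hmem => ?_
    have : s(v, w) ∈ (T.erase s(x, y)).erase s(x, z) := by simp [h1, h2, hmem]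
    rw [hpq] at this
    simp only [Finset.mem_insert, Finset.mem_singleton] at this
    exact this.elim h3 h4
  · have hP' : ∀ x y z, s(x, y) ∈ T → s(x, z) ∈ T → y = z := fun x y z h1 h2 => by
      by_contra h
      exact hP ⟨x, y, z, h, h1, h2⟩
    obtain ⟨p₁, T₃, hp₁, rfl, hT₃⟩ := Finset.card_eq_succ.mp hT
    obtain ⟨p₂, p₃, p₄, h23, h24, h34, rfl⟩ := Finset.card_eq_three.mp hT₃
    induction p₁ using Sym2.ind with
    | _ a b =>
    induction p₂ using Sym2.ind with
    | _ c d =>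
    induction p₃ using Sym2.ind with
    | _ e f =>
    induction p₄ using Sym2.ind with
    | _ g h =>
    simp only [Finset.mem_insert, Finset.mem_singleton, not_or] at hp₁ hdiag hadj hP'
    have disj : ∀ v w v' w', v ≠ w → v' ≠ w' → s(v, w) ≠ s(v', w') →
        (s(v, w) = s(a, b) ∨ s(v, w) = s(c, d) ∨ s(v, w) = s(e, f) ∨ s(v, w) = s(g, h)) →
        (s(v', w') = s(a, b) ∨ s(v', w') = s(c, d) ∨ s(v', w') = s(e, f) ∨
          s(v', w') = s(g, h)) → v ≠ v' ∧ v ≠ w' ∧ w ≠ v' ∧ w ≠ w' := by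
      intro v w v' w' _ _ hne h1 h2
      have h1' := h1
      have h2' := h2
      rw [Sym2.eq_swap] at h1' h2'
      refine ⟨?_, ?_, ?_, ?_⟩ <;> rintro rfl <;> apply hne
      · rw [hP' _ _ _ h1 h2]
      · rw [hP' _ _ _ h1 h2', Sym2.eq_swap]
      · rw [Sym2.eq_swap, hP' _ _ _ h1' h2]
      · rw [Sym2.eq_swap, hP' _ _ _ h1' h2', Sym2.eq_swap]
    have hab := hdiag a b (by simp)
    have hcd := hdiag c d (by simp)
    have hef := hdiag e f (by simp)
    have hgh := hdiag g h (by simp)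
    have d12 := disj a b c d hab hcd hp₁.1 (by simp) (by simp)
    have d13 := disj a b e f hab hef hp₁.2.1 (by simp) (by simp)
    have d14 := disj a b g h hab hgh hp₁.2.2 (by simp) (by simp)
    have d23 := disj c d e f hcd hef h23 (by simp) (by simp)
    have d24 := disj c d g h hcd hgh h24 (by simp) (by simp)
    have d34 := disj e f g h hef hgh h34 (by simp) (by simp)
    have adj_of_edge : ∀ {p q v w}, G.Adj p q → s(v, w) = s(p, q) → G.Adj v w := by
      intro p q v w hpq h
      rw [← SimpleGraph.mem_edgeSet, h]
      exact hpq
    by_cases h1 : G.Adj a b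
    · left
      refine isMinor_K7vee_of_three_disjoint_nonedges G hV c d e f g h (by simp; grind) ?_
      intro v w hvw _ _ _
      by_cases h : s(v, w) = s(a, b)
      · exact adj_of_edge h1 h
      · exact hadj v w hvw (by tauto)
    by_cases h2 : G.Adj c d
    · left
      refine isMinor_K7vee_of_three_disjoint_nonedges G hV a b e f g h (by simp; grind) ?_
      intro v w hvw _ _ _
      by_cases h : s(v, w) = s(c, d)
      · exact adj_of_edge h2 h
      · exact hadj v w hvw (by tauto)
    by_cases h3 : G.Adj e f
    · left
      refine isMinor_K7vee_of_three_disjoint_nonedges G hV a b c d g h (by simp; grind) ?_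
      intro v w hvw _ _ _
      by_cases h : s(v, w) = s(e, f)
      · exact adj_of_edge h3 h
      · exact hadj v w hvw (by tauto)
    by_cases h4 : G.Adj g h
    · left
      refine isMinor_K7vee_of_three_disjoint_nonedges G hV a b c d e f (by simp; grind) ?_
      intro v w hvw _ _ _
      by_cases h : s(v, w) = s(g, h)
      · exact adj_of_edge h4 h
      · exact hadj v w hvw (by tauto)
    right
    refine nonempty_iso_K2222_of_perfect_matching_nonedges G hV a b c d e f g h
      (by simp; grind) fun v w => ⟨fun hvw => ⟨hvw.ne, ?_, ?_, ?_, ?_⟩,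
        fun hvw => hadj v w hvw.1 hvw.2⟩
    · exact fun h => h1 (adj_of_edge hvw h.symm)
    · exact fun h => h2 (adj_of_edge hvw h.symm)
    · exact fun h => h3 (adj_of_edge hvw h.symm)
    · exact fun h => h4 (adj_of_edge hvw h.symm)

/-- every 4-connected graph with `|E(G)| ≥ 4|V(G)| - 8`, no `K7vee`-minor
and not isomorphic to `K_{2,2,2,2}` has at least 9 vertices. -/
theorem statement_6 (V : Type) [Fintype V] (G : SimpleGraph V)
    (hconn : IsKConnected 4 G)
    (hedge : 4 * (Fintype.card V : ℤ) - 8 ≤ (G.edgeSet.ncard : ℤ))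
    (hminor : ¬ IsMinor K7vee G)
    (hiso : IsEmpty (G ≃g K2222)) :
    9 ≤ Fintype.card V := by
  classical
  by_contra! hlt
  have h5 : 4 < Fintype.card V := hconn.1
  have hle : G.edgeSet.ncard ≤ (Fintype.card V).choose 2 := by
    rw [Set.ncard_eq_toFinset_card']
    exact SimpleGraph.card_edgeFinset_le_card_choose_two
  have hcases : Fintype.card V = 5 ∨ Fintype.card V = 6 ∨ Fintype.card V = 7 ∨
      Fintype.card V = 8 := by omega
  rcases hcases with h | h | h | h <;> simp only [h] at hedge hle
  · norm_num [Nat.choose] at hedge hle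
    omega
  · norm_num [Nat.choose] at hedge hle
    omega
  · exact hminor (isMinor_K7vee_of_card_eq_seven G h (by omega))
  · rcases isMinor_K7vee_or_iso_K2222_of_card_eq_eight G h (by omega) with h' | h'
    · exact hminor h'
    · exact not_isEmpty_iff.mpr h' hiso
end
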